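/- arXiv:2602.09474 — 3 statements merged into one kernel-verified Lean document; each statement's English description precedes it below -/
import Mathlib

section
/- Let (ℱ_k)_{k=0}^{K} be a filtration on a probability space and let 𝒜 be a finite set. For each k ∈ [K], let A_k be an ℱ_{k+1}-measurable random variable taking values in 𝒜; for each a ∈ 𝒜 let p_k(a) be ℱ_k-measurable with P[A_k = a ∣ ℱ_k] = p_k(a); let p̄_k(a) be an ℱ_k-measurable random variable with p̄_k(a) ≥ p_k(a); and let α_k(a) be an ℱ_k-measurable random variable with values in [0,1]. Then for every γ > 0 and every δ ∈ (0,1), with probability at least 1 − δ: Σ_{k=1}^{K} Σ_{a ∈ 𝒜} α_k(a)·( 𝟙{A_k = a} / (p̄_k(a) + γ) − p_k(a) / p̄_k(a) ) ≤ (1/γ)·ln(1/δ). -/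
open MeasureTheory Finset

/-- Integrating a bounded `m`-measurable function against the indicator of an event is the same as
integrating it against the conditional probability of that event. -/
lemma integrable_mul_and_integral_indicator_mul_eq {Ω : Type*} {m mΩ : MeasurableSpace Ω}
    {μ : Measure Ω} [IsProbabilityMeasure μ] (hm : m ≤ mΩ) {s : Set Ω} (hs : MeasurableSet s)
    {p f : Ω → ℝ} (hp : μ[s.indicator (fun _ => (1 : ℝ)) | m] =ᵐ[μ] p)
    (hf : Measurable[m] f) {C : ℝ} (hC : ∀ ω, |f ω| ≤ C) :
    Integrable (fun ω => f ω * s.indicator (fun _ => (1 : ℝ)) ω) μ ∧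
      Integrable (fun ω => f ω * p ω) μ ∧
      ∫ ω, f ω * s.indicator (fun _ => (1 : ℝ)) ω ∂μ = ∫ ω, f ω * p ω ∂μ := by
  have hI : Integrable (s.indicator (fun _ => (1 : ℝ))) μ := (integrable_const 1).indicator hs
  have hfI : Integrable (f * s.indicator (fun _ => (1 : ℝ))) μ :=
    hI.bdd_mul (hf.mono hm le_rfl).aestronglyMeasurable
      (Filter.Eventually.of_forall fun ω => by simpa using hC ω)
  have hce : μ[f * s.indicator (fun _ => (1 : ℝ)) | m] =ᵐ[μ] fun ω => f ω * p ω := by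
    filter_upwards [condExp_mul_of_stronglyMeasurable_left hf.stronglyMeasurable hfI hI, hp]
      with ω h1 h2
    rw [h1, Pi.mul_apply, h2]
  refine ⟨hfI, integrable_condExp.congr hce, ?_⟩
  rw [← integral_congr_ae hce, integral_condExp hm]
  rfl

/-- The exponential of a sum in which a single term is switched on is affine in the indicators. -/
lemma exp_sum_indicator_mul {Ω ι : Type*} [Fintype ι] (X : Ω → ι) (c : ι → ℝ) (ω : Ω) :
    Real.exp (∑ a, c a * Set.indicator {ω' | X ω' = a} (fun _ => (1 : ℝ)) ω) =
      1 + ∑ a, (Real.exp (c a) - 1) * Set.indicator {ω' | X ω' = a} (fun _ => (1 : ℝ)) ω := by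
  classical
  simp [Set.indicator_apply]

/-- One-step bound: compensating the exponent at rate `d` does not increase the expectation. -/
lemma integral_mul_exp_indicator_sub_le {Ω ι : Type*} [Fintype ι] {m mΩ : MeasurableSpace Ω}
    {μ : Measure Ω} [IsProbabilityMeasure μ] (hm : m ≤ mΩ) {X : Ω → ι}
    (hX : ∀ a, MeasurableSet {ω | X ω = a}) {p c d : ι → Ω → ℝ} {M : Ω → ℝ}
    (hp : ∀ a, μ[Set.indicator {ω | X ω = a} (fun _ => (1 : ℝ)) | m] =ᵐ[μ] p a)
    (hc : ∀ a, Measurable[m] (c a)) (hd : ∀ a, Measurable[m] (d a)) (hM : Measurable[m] M)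
    (hc0 : ∀ a ω, 0 ≤ c a ω) (hc1 : ∀ a ω, c a ω ≤ 1) (hd0 : ∀ a ω, 0 ≤ d a ω)
    (hM0 : ∀ ω, 0 ≤ M ω) {C : ℝ} (hMC : ∀ ω, M ω ≤ C)
    (hcd : ∀ a ω, (Real.exp (c a ω) - 1) * p a ω ≤ d a ω) :
    ∫ ω, M ω * Real.exp (∑ a, (c a ω * Set.indicator {ω' | X ω' = a} (fun _ => (1 : ℝ)) ω
      - d a ω)) ∂μ ≤ ∫ ω, M ω ∂μ := by
  set D : Ω → ℝ := fun ω => ∑ a, d a ω with hD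
  set g : Ω → ℝ := fun ω => M ω * Real.exp (-D ω) with hg
  have hDm : Measurable[m] D := Finset.measurable_sum _ fun a _ => hd a
  have hgm : Measurable[m] g := hM.mul hDm.neg.exp
  have hg0 : ∀ ω, 0 ≤ g ω := fun ω => mul_nonneg (hM0 ω) (Real.exp_nonneg _)
  have hgM : ∀ ω, g ω ≤ M ω := fun ω => mul_le_of_le_one_right (hM0 ω) <|
    Real.exp_le_one_iff.2 (neg_nonpos.2 (Finset.sum_nonneg fun a _ => hd0 a ω))
  have hMi : Integrable M μ :=
    Integrable.of_bound (hM.mono hm le_rfl).aestronglyMeasurable C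
      (Filter.Eventually.of_forall fun ω => by
        rw [Real.norm_of_nonneg (hM0 ω)]; exact hMC ω)
  have hgi : Integrable g μ :=
    Integrable.of_bound (hgm.mono hm le_rfl).aestronglyMeasurable C
      (Filter.Eventually.of_forall fun ω => by
        rw [Real.norm_of_nonneg (hg0 ω)]; exact (hgM ω).trans (hMC ω))
  have key := fun a => integrable_mul_and_integral_indicator_mul_eq hm (hX a) (hp a)
    (f := fun ω => g ω * (Real.exp (c a ω) - 1))
    (hgm.mul ((hc a).exp.sub_const 1)) (C := C * (Real.exp 1 - 1)) (fun ω => by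
      have h1 : 0 ≤ Real.exp (c a ω) - 1 := by linarith [Real.one_le_exp (hc0 a ω)]
      have h2 : Real.exp (c a ω) ≤ Real.exp 1 := Real.exp_le_exp.2 (hc1 a ω)
      rw [abs_of_nonneg (mul_nonneg (hg0 ω) h1)]
      exact mul_le_mul ((hgM ω).trans (hMC ω)) (by linarith) h1 ((hM0 ω).trans (hMC ω)))
  calc ∫ ω, M ω * Real.exp (∑ a, (c a ω * Set.indicator {ω' | X ω' = a} (fun _ => (1 : ℝ)) ω
          - d a ω)) ∂μ
      = ∫ ω, (g ω + ∑ a, g ω * (Real.exp (c a ω) - 1) *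
          Set.indicator {ω' | X ω' = a} (fun _ => (1 : ℝ)) ω) ∂μ := by
        congr 1 with ω
        rw [Finset.sum_sub_distrib, sub_eq_add_neg, Real.exp_add,
          exp_sum_indicator_mul X (fun a => c a ω) ω]
        simp only [hg, hD, mul_assoc, ← Finset.mul_sum]
        ring
    _ = ∫ ω, (g ω + ∑ a, g ω * (Real.exp (c a ω) - 1) * p a ω) ∂μ := by
        rw [integral_add hgi (integrable_finsetSum _ fun a _ => (key a).1),
          integral_add hgi (integrable_finsetSum _ fun a _ => (key a).2.1),
          integral_finsetSum _ fun a _ => (key a).1, integral_finsetSum _ fun a _ => (key a).2.1]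
        simp only [(key _).2.2]
    _ ≤ ∫ ω, M ω ∂μ := by
        refine integral_mono (hgi.add (integrable_finsetSum _ fun a _ => (key a).2.1)) hMi
          fun ω => ?_
        calc g ω + ∑ a, g ω * (Real.exp (c a ω) - 1) * p a ω
            = g ω * (∑ a, (Real.exp (c a ω) - 1) * p a ω + 1) := by
              simp only [mul_assoc, ← Finset.mul_sum]; ring
          _ ≤ g ω * Real.exp (D ω) := by
              refine mul_le_mul_of_nonneg_left ?_ (hg0 ω)
              exact (add_le_add_left (Finset.sum_le_sum fun a _ => hcd a ω) 1).trans
                (Real.add_one_le_exp _)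
          _ = M ω := by simp [hg, mul_assoc, ← Real.exp_add]

/-- The elementary inequality behind implicit exploration. -/
lemma exp_implicit_exploration_sub_one_mul_le {p q α γ : ℝ} (hp : 0 ≤ p) (hpq : p ≤ q)
    (hα : α ∈ Set.Icc (0 : ℝ) 1) (hγ : 0 < γ) :
    (Real.exp (γ * α / (q + γ)) - 1) * p ≤ γ * α * (p / q) := by
  obtain ⟨h0, h1⟩ := hα
  rcases hp.eq_or_lt with rfl | hp
  · simp
  have hq : 0 < q := hp.trans_le hpq
  have hz : 0 ≤ γ * α := by positivity
  have h2 : γ * α / (q + γ) ≤ γ * α / (q + γ * α) := by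
    gcongr
    nlinarith
  have h3 : Real.exp (γ * α / (q + γ * α)) ≤ 1 + γ * α / q := by
    have := Real.one_sub_inv_le_log_of_pos (x := 1 + γ * α / q) (by positivity)
    rw [← Real.le_log_iff_exp_le (by positivity)]
    convert this using 1
    field_simp
    ring
  have h4 : Real.exp (γ * α / (q + γ)) - 1 ≤ γ * α / q := by
    linarith [Real.exp_le_exp.2 h2]
  calc _ ≤ γ * α / q * p := by gcongr
    _ = _ := by ring

/-- The exponential moment of the compensated sum is at most one. -/
lemma integral_exp_implicit_exploration_le_one
    {Ω : Type*} {mΩ : MeasurableSpace Ω} {μ : Measure Ω} [IsProbabilityMeasure μ]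
    {ι : Type*} [Fintype ι] [MeasurableSpace ι] [MeasurableSingletonClass ι]
    (ℱ : Filtration ℕ mΩ) {A : ℕ → Ω → ι} {p q α : ℕ → ι → Ω → ℝ}
    (hA : ∀ k, Measurable[ℱ (k + 1)] (A k)) (hp : ∀ k a, Measurable[ℱ k] (p k a))
    (hq : ∀ k a, Measurable[ℱ k] (q k a)) (hα : ∀ k a, Measurable[ℱ k] (α k a))
    (hcond : ∀ k a,
      μ[Set.indicator {ω | A k ω = a} (fun _ => (1 : ℝ)) | ℱ k] =ᵐ[μ] p k a)
    (hp0 : ∀ k a ω, 0 ≤ p k a ω) (hpq : ∀ k a ω, p k a ω ≤ q k a ω)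
    (hα01 : ∀ k a ω, α k a ω ∈ Set.Icc (0 : ℝ) 1) {γ : ℝ} (hγ : 0 < γ) (n : ℕ) :
    Integrable (fun ω => Real.exp (∑ k ∈ range n, ∑ a, (γ * α k a ω / (q k a ω + γ) *
        Set.indicator {ω' | A k ω' = a} (fun _ => (1 : ℝ)) ω
          - γ * α k a ω * (p k a ω / q k a ω)))) μ ∧
      ∫ ω, Real.exp (∑ k ∈ range n, ∑ a, (γ * α k a ω / (q k a ω + γ) *
        Set.indicator {ω' | A k ω' = a} (fun _ => (1 : ℝ)) ω
          - γ * α k a ω * (p k a ω / q k a ω))) ∂μ ≤ 1 := by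
  set c : ℕ → ι → Ω → ℝ := fun k a ω => γ * α k a ω / (q k a ω + γ) with hc
  set d : ℕ → ι → Ω → ℝ := fun k a ω => γ * α k a ω * (p k a ω / q k a ω) with hd
  set I : ℕ → ι → Ω → ℝ := fun k a => Set.indicator {ω' | A k ω' = a} (fun _ => (1 : ℝ)) with hI
  set S : ℕ → Ω → ℝ := fun n ω => ∑ k ∈ range n, ∑ a, (c k a ω * I k a ω - d k a ω) with hS
  have hq0 : ∀ k a ω, 0 ≤ q k a ω := fun k a ω => (hp0 k a ω).trans (hpq k a ω)
  have hcm : ∀ k a, Measurable[ℱ k] (c k a) := fun k a =>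
    ((hα k a).const_mul γ).div ((hq k a).add_const γ)
  have hdm : ∀ k a, Measurable[ℱ k] (d k a) := fun k a =>
    ((hα k a).const_mul γ).mul ((hp k a).div (hq k a))
  have hset : ∀ k a, MeasurableSet[ℱ (k + 1)] {ω | A k ω = a} := fun k a =>
    hA k (measurableSet_singleton a)
  have hIm : ∀ k a, Measurable[ℱ (k + 1)] (I k a) := fun k a =>
    measurable_const.indicator (hset k a)
  have hc0 : ∀ k a ω, 0 ≤ c k a ω := fun k a ω =>
    div_nonneg (mul_nonneg hγ.le (hα01 k a ω).1) (by linarith [hq0 k a ω])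
  have hc1 : ∀ k a ω, c k a ω ≤ 1 := fun k a ω =>
    div_le_one_of_le₀ (by nlinarith [hq0 k a ω, (hα01 k a ω).2]) (by linarith [hq0 k a ω])
  have hd0 : ∀ k a ω, 0 ≤ d k a ω := fun k a ω =>
    mul_nonneg (mul_nonneg hγ.le (hα01 k a ω).1) (div_nonneg (hp0 k a ω) (hq0 k a ω))
  have hSm : ∀ n, Measurable[ℱ n] (S n) := fun n =>
    Finset.measurable_sum _ fun k hk => Finset.measurable_sum _ fun a _ => by
      have hk' := Finset.mem_range.1 hk
      exact (((hcm k a).mono (ℱ.mono hk'.le) le_rfl).mul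
        ((hIm k a).mono (ℱ.mono hk') le_rfl)).sub ((hdm k a).mono (ℱ.mono hk'.le) le_rfl)
  have hSb : ∀ n ω, S n ω ≤ ∑ k ∈ range n, ∑ _a : ι, (1 : ℝ) := fun n ω =>
    Finset.sum_le_sum fun k _ => Finset.sum_le_sum fun a _ => by
      have h1 : I k a ω ≤ 1 := Set.indicator_le_self' (fun _ _ => zero_le_one) ω
      linarith [mul_le_of_le_one_right (hc0 k a ω) h1, hc1 k a ω, hd0 k a ω]
  refine ⟨Integrable.of_bound
    ((hSm n).exp.mono (ℱ.le n) le_rfl).aestronglyMeasurable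
    (Real.exp (∑ k ∈ range n, ∑ _a : ι, (1 : ℝ))) (Filter.Eventually.of_forall fun ω => by
      rw [Real.norm_of_nonneg (Real.exp_nonneg _)]
      exact Real.exp_le_exp.2 (hSb n ω)), ?_⟩
  change ∫ ω, Real.exp (S n ω) ∂μ ≤ 1
  induction n with
  | zero => simp [hS]
  | succ n ih =>
    have hstep := integral_mul_exp_indicator_sub_le (μ := μ) (ℱ.le n) (X := A n)
      (fun a => ℱ.le _ _ (hset n a)) (hcond n) (hcm n) (hdm n) (hSm n).exp (hc0 n) (hc1 n)
      (hd0 n) (fun ω => Real.exp_nonneg _) (fun ω => Real.exp_le_exp.2 (hSb n ω))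
      (fun a ω => exp_implicit_exploration_sub_one_mul_le (hp0 n a ω) (hpq n a ω)
        (hα01 n a ω) hγ)
    refine le_trans (le_of_eq ?_) (hstep.trans ih)
    simp only [hS, Finset.sum_range_succ, Real.exp_add, hI]

/-- **Concentration lemma** (adapted from Lemma 11 of Jin et al., Lemma
`lem:neu_stuff`).  Let `(ℱ_k)` be a filtration, `𝒜` a finite set, and for
each `k` let `A_k` be an `ℱ_{k+1}`-measurable random variable with values in
`𝒜`, let `p_k(a)` be `ℱ_k`-measurable with `P[A_k = a ∣ ℱ_k] = p_k(a)`, let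
`p̄_k(a) ≥ p_k(a)` be `ℱ_k`-measurable, and let `α_k(a)` be `ℱ_k`-measurable
with values in `[0,1]`.  Then for every `γ > 0` and `δ ∈ (0,1)`, with
probability at least `1 − δ`,
`∑_{k<K} ∑_{a} α_k(a)·(𝟙{A_k = a}/(p̄_k(a)+γ) − p_k(a)/p̄_k(a)) ≤ (1/γ)·ln(1/δ)`. -/
theorem implicit_exploration_concentration
    {Ω : Type*} {mΩ : MeasurableSpace Ω} {μ : Measure Ω} [IsProbabilityMeasure μ]
    {𝒜 : Type*} [Fintype 𝒜] [MeasurableSpace 𝒜] [MeasurableSingletonClass 𝒜]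
    (K : ℕ) (ℱ : Filtration ℕ mΩ)
    (A : ℕ → Ω → 𝒜) (p pbar α : ℕ → 𝒜 → Ω → ℝ)
    (hA : ∀ k, Measurable[ℱ (k + 1)] (A k))
    (hp : ∀ k a, Measurable[ℱ k] (p k a))
    (hpbar : ∀ k a, Measurable[ℱ k] (pbar k a))
    (hα : ∀ k a, Measurable[ℱ k] (α k a))
    (hcond : ∀ k a,
      μ[Set.indicator {ω | A k ω = a} (fun _ => (1 : ℝ)) | ℱ k] =ᵐ[μ] p k a)
    (hub : ∀ k a ω, p k a ω ≤ pbar k a ω)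
    (hα01 : ∀ k a ω, α k a ω ∈ Set.Icc (0 : ℝ) 1)
    (γ δ : ℝ) (hγ : 0 < γ) (hδ : δ ∈ Set.Ioo (0 : ℝ) 1) :
    ENNReal.ofReal (1 - δ) ≤
      μ {ω | ∑ k ∈ range K, ∑ a : 𝒜,
          α k a ω *
            ((Set.indicator {ω' | A k ω' = a} (fun _ => (1 : ℝ)) ω) /
                (pbar k a ω + γ) -
              p k a ω / pbar k a ω) ≤
        1 / γ * Real.log (1 / δ)} := by
  have hp0 : ∀ᵐ ω ∂μ, ∀ k a, 0 ≤ p k a ω := by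
    refine ae_all_iff.2 fun k => ae_all_iff.2 fun a => ?_
    filter_upwards [hcond k a, condExp_nonneg (μ := μ) (m := ℱ k)
      (f := Set.indicator {ω | A k ω = a} (fun _ => (1 : ℝ)))
      (Filter.Eventually.of_forall fun ω => Set.indicator_nonneg (fun _ _ => zero_le_one) ω)]
      with ω h1 h2
    rw [← h1]
    exact h2
  obtain ⟨hexpInt, hle⟩ := integral_exp_implicit_exploration_le_one (μ := μ) ℱ hA
    (p := fun k a ω => max (p k a ω) 0) (q := fun k a ω => max (pbar k a ω) 0)
    (fun k a => (hp k a).max measurable_const) (fun k a => (hpbar k a).max measurable_const) hα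
    (fun k a => by
      filter_upwards [hcond k a, hp0] with ω h1 h2
      rw [h1, max_eq_left (h2 k a)])
    (fun k a ω => le_max_right _ _) (fun k a ω => max_le_max_right 0 (hub k a ω)) hα01 hγ K
  have hmarkov := mul_meas_ge_le_integral_of_nonneg
    (Filter.Eventually.of_forall fun ω => Real.exp_nonneg _) hexpInt (1 / δ)
  set T := {ω | ∑ k ∈ range K, ∑ a : 𝒜,
          α k a ω *
            ((Set.indicator {ω' | A k ω' = a} (fun _ => (1 : ℝ)) ω) /
                (pbar k a ω + γ) -
              p k a ω / pbar k a ω) ≤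
        1 / γ * Real.log (1 / δ)}
  have hTc : μ Tᶜ ≤ ENNReal.ofReal δ := by
    have hreal := hmarkov.trans hle
    rw [one_div, inv_mul_le_iff₀ hδ.1, mul_one] at hreal
    refine le_trans (measure_mono_ae ?_)
      ((ENNReal.le_ofReal_iff_toReal_le (measure_ne_top μ _) hδ.1.le).2 hreal)
    filter_upwards [hp0] with ω h0 hω
    have hω' : 1 / γ * Real.log (1 / δ) < _ := not_le.1 hω
    rw [one_div, inv_mul_lt_iff₀ hγ] at hω'
    change δ⁻¹ ≤ Real.exp _
    rw [← one_div, ← Real.log_le_iff_le_exp (one_div_pos.2 hδ.1)]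
    refine hω'.le.trans (le_of_eq ?_)
    simp only [Finset.mul_sum]
    refine Finset.sum_congr rfl fun k _ => Finset.sum_congr rfl fun a _ => ?_
    rw [max_eq_left (h0 k a), max_eq_left ((h0 k a).trans (hub k a ω))]
    ring
  have h1 : (1 : ENNReal) ≤ μ T + μ Tᶜ := by
    rw [← measure_univ (μ := μ), ← Set.union_compl_self T]
    exact measure_union_le _ _
  rw [ENNReal.ofReal_sub _ hδ.1.le, ENNReal.ofReal_one, tsub_le_iff_right]
  exact h1.trans (add_le_add_right hTc _)
end

section
/- With the notation below, for every step h ∈ [H], every state s ∈ 𝒮 and every action a ∈ 𝒜, the occupancy measure factorizes through conditioned occupancy measures: q_h^{p,π}(s,a) = Σ_{c ∈ 𝒞_h} μ_h^{p,π}(s,a,c)·ϱ^p(c). -/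
open Finset
open scoped Classical

namespace COM

variable {S A : ℕ}

/-- The occupancy measure `q_h^{p,π}(s,a)`: the sum, over trajectory prefixes
`(s₀,a₀,…,s_h,a_h)` with `s₀ = sinit`, `s_h = s`, `a_h = a`, of the product
of the policy probabilities and all transition probabilities along the
prefix.  (Steps are 0-indexed.) -/
noncomputable def occup (p : ℕ → Fin S → Fin A → Fin S → ℝ)
    (π : ℕ → Fin S → Fin A → ℝ) (sinit : Fin S) (h : ℕ) (s : Fin S) (a : Fin A) : ℝ :=
  ∑ t ∈ univ.filter (fun t : Fin (h + 1) → Fin S × Fin A =>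
      (t 0).1 = sinit ∧ t (Fin.last h) = (s, a)),
    (∏ h' : Fin (h + 1), π h' (t h').1 (t h').2) *
      ∏ h' : Fin h, p h' (t h'.castSucc).1 (t h'.castSucc).2 (t h'.succ).1

/-- A condition `c ∈ 𝒞_h`: an assignment of a triple
`(σ_{h'}, α_{h'}, σ'_{h'}) ∈ 𝒮 × 𝒜 × 𝒮` to every adversarial step `h' ∈ Λ_h`
(i.e. `h' ∈ Λ`, `h' < h`), consistent in the sense that if both `h'` and
`h' + 1` lie in `Λ_h` then the third component at `h'` equals the first
component at `h' + 1`.  Conditions are canonically extended by `default`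
outside `Λ_h` so that distinct elements of the `Finset` of conditions
correspond to distinct conditions. -/
def IsCond [NeZero S] [NeZero A] {H : ℕ} (Λ : Finset ℕ) (h : ℕ)
    (c : Fin H → Fin S × Fin A × Fin S) : Prop :=
  (∀ m m' : Fin H, (m : ℕ) ∈ Λ → (m : ℕ) < h → (m' : ℕ) ∈ Λ → (m' : ℕ) < h →
      (m' : ℕ) = (m : ℕ) + 1 → (c m).2.2 = (c m').1) ∧
  ∀ m : Fin H, ¬((m : ℕ) ∈ Λ ∧ (m : ℕ) < h) → c m = default

/-- The conditioned occupancy measure `μ_h^{p,π}(s,a,c)`: the sum, over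
trajectory prefixes consistent with the condition `c`, with `s₀ = sinit`,
`s_h = s`, `a_h = a`, of the product of policy probabilities and of the
transition probabilities at the non-adversarial steps. -/
noncomputable def condOccup {H : ℕ} (p : ℕ → Fin S → Fin A → Fin S → ℝ)
    (π : ℕ → Fin S → Fin A → ℝ) (sinit : Fin S) (Λ : Finset ℕ)
    (h : ℕ) (hh : h ≤ H) (s : Fin S) (a : Fin A)
    (c : Fin H → Fin S × Fin A × Fin S) : ℝ :=
  ∑ t ∈ univ.filter (fun t : Fin (h + 1) → Fin S × Fin A =>
      (t 0).1 = sinit ∧ t (Fin.last h) = (s, a) ∧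
      ∀ h' : Fin h, (h' : ℕ) ∈ Λ →
        (t h'.castSucc).1 = (c ⟨h', lt_of_lt_of_le h'.2 hh⟩).1 ∧
        (t h'.castSucc).2 = (c ⟨h', lt_of_lt_of_le h'.2 hh⟩).2.1 ∧
        (t h'.succ).1 = (c ⟨h', lt_of_lt_of_le h'.2 hh⟩).2.2),
    (∏ h' : Fin (h + 1), π h' (t h').1 (t h').2) *
      ∏ h' ∈ univ.filter (fun h' : Fin h => (h' : ℕ) ∉ Λ),
        p h' (t h'.castSucc).1 (t h'.castSucc).2 (t h'.succ).1

/-- `ϱ^p(c)`: the product, over the adversarial steps `h' ∈ Λ_h`, of the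
transition probabilities of the triples prescribed by the condition `c`. -/
noncomputable def condProb {H : ℕ} (p : ℕ → Fin S → Fin A → Fin S → ℝ)
    (Λ : Finset ℕ) (h : ℕ) (c : Fin H → Fin S × Fin A × Fin S) : ℝ :=
  ∏ m ∈ univ.filter (fun m : Fin H => (m : ℕ) ∈ Λ ∧ (m : ℕ) < h),
    p m (c m).1 (c m).2.1 (c m).2.2

/-- The condition induced by a trajectory prefix: the triples it visits at the adversarial steps. -/
noncomputable def trajCond [NeZero S] [NeZero A] {H : ℕ} (Λ : Finset ℕ) {h : ℕ}
    (t : Fin (h + 1) → Fin S × Fin A) (m : Fin H) : Fin S × Fin A × Fin S :=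
  if hm : (m : ℕ) ∈ Λ ∧ (m : ℕ) < h then
    ((t (Fin.castSucc ⟨m, hm.2⟩)).1, (t (Fin.castSucc ⟨m, hm.2⟩)).2, (t (Fin.succ ⟨m, hm.2⟩)).1)
  else default

theorem trajCond_of_mem [NeZero S] [NeZero A] {H : ℕ} {Λ : Finset ℕ} {h : ℕ}
    (t : Fin (h + 1) → Fin S × Fin A) {m : Fin H} (hΛ : (m : ℕ) ∈ Λ) (hm : (m : ℕ) < h) :
    trajCond Λ t m = ((t (Fin.castSucc ⟨m, hm⟩)).1, (t (Fin.castSucc ⟨m, hm⟩)).2,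
      (t (Fin.succ ⟨m, hm⟩)).1) :=
  dif_pos ⟨hΛ, hm⟩

theorem isCond_trajCond [NeZero S] [NeZero A] {H : ℕ} (Λ : Finset ℕ) {h : ℕ}
    (t : Fin (h + 1) → Fin S × Fin A) : IsCond (H := H) Λ h (trajCond Λ t) := by
  refine ⟨fun m m' hm hmh hm' hmh' heq => ?_, fun m hm => dif_neg hm⟩
  rw [trajCond_of_mem t hm hmh, trajCond_of_mem t hm' hmh']
  have : Fin.succ ⟨m, hmh⟩ = Fin.castSucc ⟨m', hmh'⟩ := Fin.ext heq.symm
  simp only [this]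

/-- A trajectory prefix is consistent with exactly one condition, the one it induces. -/
theorem consistent_iff_eq_trajCond [NeZero S] [NeZero A] {H : ℕ} {Λ : Finset ℕ} {h : ℕ}
    (hh : h ≤ H) {c : Fin H → Fin S × Fin A × Fin S} (hc : IsCond Λ h c)
    (t : Fin (h + 1) → Fin S × Fin A) :
    (∀ h' : Fin h, (h' : ℕ) ∈ Λ →
        (t h'.castSucc).1 = (c ⟨h', lt_of_lt_of_le h'.2 hh⟩).1 ∧
        (t h'.castSucc).2 = (c ⟨h', lt_of_lt_of_le h'.2 hh⟩).2.1 ∧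
        (t h'.succ).1 = (c ⟨h', lt_of_lt_of_le h'.2 hh⟩).2.2) ↔ c = trajCond Λ t := by
  constructor
  · intro hcons
    funext m
    by_cases hm : (m : ℕ) ∈ Λ ∧ (m : ℕ) < h
    · obtain ⟨h₁, h₂, h₃⟩ := hcons ⟨m, hm.2⟩ hm.1
      rw [trajCond_of_mem t hm.1 hm.2, h₁, h₂, h₃]
    · rw [hc.2 m hm, (isCond_trajCond Λ t).2 m hm]
  · rintro rfl h' hΛ
    rw [trajCond_of_mem t (m := ⟨h', lt_of_lt_of_le h'.2 hh⟩) hΛ h'.2]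
    exact ⟨rfl, rfl, rfl⟩

theorem condProb_trajCond [NeZero S] [NeZero A] {H : ℕ}
    (p : ℕ → Fin S → Fin A → Fin S → ℝ) (Λ : Finset ℕ) {h : ℕ} (hh : h ≤ H)
    (t : Fin (h + 1) → Fin S × Fin A) :
    condProb (H := H) p Λ h (trajCond Λ t) =
      ∏ h' ∈ univ.filter (fun h' : Fin h => (h' : ℕ) ∈ Λ),
        p h' (t h'.castSucc).1 (t h'.castSucc).2 (t h'.succ).1 := by
  symm
  refine prod_bij (fun h' _ => Fin.castLE hh h') ?_ ?_ ?_ ?_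
  · intro h' hΛ
    simpa using hΛ
  · intro x _ y _ hxy
    exact Fin.castLE_injective hh hxy
  · intro m hm
    obtain ⟨hΛ, hmh⟩ := (mem_filter.mp hm).2
    exact ⟨⟨m, hmh⟩, by simpa using hΛ, rfl⟩
  · intro h' hΛ
    rw [trajCond_of_mem t (m := Fin.castLE hh h') (mem_filter.mp hΛ).2 h'.2]
    rfl

/-- **Occupancy measures factorize through conditioned occupancy measures**
(Lemma `lem:com_to_om`): for every step `h`, state `s` and action `a`,
`q_h^{p,π}(s,a) = ∑_{c ∈ 𝒞_h} μ_h^{p,π}(s,a,c) · ϱ^p(c)`. -/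
theorem occup_eq_sum_condOccup [NeZero S] [NeZero A]
    (H : ℕ) (Λ : Finset ℕ) (hΛ : Λ ⊆ range (H - 1))
    (p : ℕ → Fin S → Fin A → Fin S → ℝ)
    (hp : ∀ h', (∀ s a s'', 0 ≤ p h' s a s'') ∧ ∀ s a, ∑ s'', p h' s a s'' = 1)
    (π : ℕ → Fin S → Fin A → ℝ)
    (hπ : ∀ h' s, (∀ a, 0 ≤ π h' s a) ∧ ∑ a, π h' s a = 1)
    (sinit : Fin S) (h : ℕ) (hh : h < H) (s : Fin S) (a : Fin A) :
    occup p π sinit h s a =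
      ∑ c ∈ univ.filter (IsCond (S := S) (A := A) (H := H) Λ h),
        condOccup p π sinit Λ h hh.le s a c * condProb p Λ h c := by
  simp only [occup, condOccup, sum_filter (s := (univ : Finset (Fin (h + 1) → Fin S × Fin A))),
    sum_mul]
  rw [sum_comm]
  refine sum_congr rfl fun t _ => ?_
  by_cases ht : (t 0).1 = sinit ∧ t (Fin.last h) = (s, a)
  · rw [if_pos ht, sum_eq_single (trajCond Λ t)]
    · rw [if_pos ⟨ht.1, ht.2, (consistent_iff_eq_trajCond hh.le (isCond_trajCond Λ t) t).2 rfl⟩,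
        condProb_trajCond p Λ hh.le t, mul_assoc, mul_comm (∏ h' ∈ _ with _ ∉ Λ, _),
        prod_filter_mul_prod_filter_not]
    · intro c hc hne
      rw [if_neg, zero_mul]
      exact fun hcons =>
        hne ((consistent_iff_eq_trajCond hh.le (mem_filter.mp hc).2 t).1 hcons.2.2)
    · exact fun hnot => absurd (mem_filter.mpr ⟨mem_univ _, isCond_trajCond Λ t⟩) hnot
  · rw [if_neg ht]
    refine (sum_eq_zero fun c _ => ?_).symm
    rw [if_neg fun hcons => ht ⟨hcons.1, hcons.2.1⟩, zero_mul]

end COM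
end

section
/- Fix integers A ≥ 2, H ≥ 1 and K ≥ A^H. There exists a universal constant c > 0 such that for every learning algorithm operating with bandit feedback on both losses and transitions there is an episodic adversarial MDP instance with exactly S = 2 states (and possibly stochastically generated losses and transitions) on which the expected regret satisfies E[R_K] ≥ c·√(A^H · K). -/
open Finset

namespace AdvMDP

variable {S A : ℕ}

/-- A per-step transition kernel: a probability distribution over next states
for every (state, action) pair. -/
def IsKernel (p : Fin S → Fin A → Fin S → ℝ) : Prop :=
  (∀ s a s', 0 ≤ p s a s') ∧ ∀ s a, ∑ s', p s a s' = 1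

/-- A transition function for an `H`-step episode: a kernel for every step
`h` with `h + 1 < H` (the transition from step `h` to step `h+1`). -/
def IsTrans (H : ℕ) (p : ℕ → Fin S → Fin A → Fin S → ℝ) : Prop :=
  ∀ h, h + 1 < H → IsKernel (p h)

/-- A loss function for an `H`-step episode, with values in `[0,1]`. -/
def IsLoss (H : ℕ) (ℓ : ℕ → Fin S → Fin A → ℝ) : Prop :=
  ∀ h s a, h < H → 0 ≤ ℓ h s a ∧ ℓ h s a ≤ 1

/-- A (stochastic) Markov policy. -/
def IsPolicy (π : ℕ → Fin S → Fin A → ℝ) : Prop :=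
  (∀ h s a, 0 ≤ π h s a) ∧ ∀ h s, ∑ a, π h s a = 1

/-- The distribution over states at step `h` induced by a Markov policy `π`
under transitions `p`, starting from `sinit`. -/
noncomputable def stateDist (p : ℕ → Fin S → Fin A → Fin S → ℝ)
    (π : ℕ → Fin S → Fin A → ℝ) (sinit : Fin S) : ℕ → Fin S → ℝ
  | 0 => fun s => if s = sinit then 1 else 0
  | h + 1 => fun s' => ∑ s, ∑ a, stateDist p π sinit h s * π h s a * p h s a s'

/-- The value `V₁^{π,p,ℓ}` of a Markov policy: the expected cumulative loss
over an `H`-step episode. -/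
noncomputable def value (H : ℕ) (p : ℕ → Fin S → Fin A → Fin S → ℝ)
    (π : ℕ → Fin S → Fin A → ℝ) (ℓ : ℕ → Fin S → Fin A → ℝ) (sinit : Fin S) : ℝ :=
  ∑ h ∈ range H, ∑ s, ∑ a, stateDist p π sinit h s * π h s a * ℓ h s a

/-- The benchmark: the best cumulative value over `K` episodes achievable by a
fixed Markov policy. -/
noncomputable def bestValue (H K : ℕ) (p : ℕ → ℕ → Fin S → Fin A → Fin S → ℝ)
    (ℓ : ℕ → ℕ → Fin S → Fin A → ℝ) (sinit : Fin S) : ℝ :=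
  sInf {x : ℝ | ∃ π : ℕ → Fin S → Fin A → ℝ,
    IsPolicy π ∧ x = ∑ k ∈ range K, value H (p k) π (ℓ k) sinit}

/-- A strategy: a rule assigning to every within-episode trajectory prefix
(the list of past state-action pairs) and current state a distribution over
actions. -/
def IsStrategy (σ : List (Fin S × Fin A) → Fin S → Fin A → ℝ) : Prop :=
  (∀ t s a, 0 ≤ σ t s a) ∧ ∀ t s, ∑ a, σ t s a = 1

/-- Probability that, starting at step `h` in state `s` with within-episode
history `hist`, the strategy `σ` under transitions `p` produces exactly the
remaining trajectory `rest`. -/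
noncomputable def trajProb (p : ℕ → Fin S → Fin A → Fin S → ℝ)
    (σ : List (Fin S × Fin A) → Fin S → Fin A → ℝ) :
    ℕ → Fin S → List (Fin S × Fin A) → List (Fin S × Fin A) → ℝ
  | _, _, _, [] => 1
  | _, s, hist, [(s', a)] => if s' = s then σ hist s a else 0
  | h, s, hist, (s', a) :: (s'', a'') :: rest =>
      (if s' = s then σ hist s a else 0) * p h s' a s'' *
        trajProb p σ (h + 1) s'' (hist ++ [(s', a)]) ((s'', a'') :: rest)

/-- Probability that strategy `σ` produces the full `H`-step trajectory `t`. -/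
noncomputable def trajDist (H : ℕ) (p : ℕ → Fin S → Fin A → Fin S → ℝ)
    (σ : List (Fin S × Fin A) → Fin S → Fin A → ℝ) (sinit : Fin S)
    (t : Fin H → Fin S × Fin A) : ℝ :=
  trajProb p σ 0 sinit [] (List.ofFn t)

/-- Cumulative loss along a trajectory. -/
noncomputable def trajLoss (H : ℕ) (ℓ : ℕ → Fin S → Fin A → ℝ)
    (t : Fin H → Fin S × Fin A) : ℝ :=
  ∑ h : Fin H, ℓ h (t h).1 (t h).2

/-- The value `V₁^{σ,p,ℓ}` of a history-dependent strategy. -/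
noncomputable def stratValue (H : ℕ) (p : ℕ → Fin S → Fin A → Fin S → ℝ)
    (σ : List (Fin S × Fin A) → Fin S → Fin A → ℝ) (ℓ : ℕ → Fin S → Fin A → ℝ)
    (sinit : Fin S) : ℝ :=
  ∑ t : Fin H → Fin S × Fin A, trajDist H p σ sinit t * trajLoss H ℓ t

/-- A (randomized) learning algorithm with per-episode observations of type
`Obs`: a random seed (drawn once, with distribution `w`) together with a map
from the seed and the list of past observations to the strategy played in the
next episode. -/
structure Alg (S A : ℕ) (Obs : Type) where
  w : ℕ → ℝ
  w_nonneg : ∀ i, 0 ≤ w i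
  w_sum : ∑' i, w i = 1
  act : ℕ → List Obs → List (Fin S × Fin A) → Fin S → Fin A → ℝ
  act_strat : ∀ i past, IsStrategy (act i past)

/-- The strategy played by algorithm `alg` (with seed `i`) in episode `k`,
when the realized trajectories so far are `ts` and the per-episode
observations are produced by `obs`. -/
noncomputable def played {Obs : Type} {H K : ℕ} (alg : Alg S A Obs) (i : ℕ)
    (obs : ℕ → (Fin H → Fin S × Fin A) → Obs)
    (ts : Fin K → Fin H → Fin S × Fin A) (k : Fin K) :
    List (Fin S × Fin A) → Fin S → Fin A → ℝ :=
  alg.act i (List.ofFn fun j : Fin (k : ℕ) =>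
    obs (j : ℕ) (ts ⟨(j : ℕ), j.2.trans k.2⟩))

/-- The probability that the interaction of algorithm `alg` (with seed `i`)
with the episodic MDP `(p, obs)` produces the sequence of trajectories `ts`. -/
noncomputable def seqProb {Obs : Type} {H K : ℕ} (alg : Alg S A Obs) (i : ℕ)
    (p : ℕ → ℕ → Fin S → Fin A → Fin S → ℝ)
    (obs : ℕ → (Fin H → Fin S × Fin A) → Obs) (sinit : Fin S)
    (ts : Fin K → Fin H → Fin S × Fin A) : ℝ :=
  ∏ k : Fin K, trajDist H (p k) (played alg i obs ts k) sinit (ts k)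

/-- The realized total value `∑_k V₁^{π^k,p^k,ℓ^k}` of the strategies selected
by the algorithm along the history `(i, ts)`. -/
noncomputable def playedValue {Obs : Type} (H K : ℕ) (alg : Alg S A Obs) (i : ℕ)
    (p : ℕ → ℕ → Fin S → Fin A → Fin S → ℝ) (ℓ : ℕ → ℕ → Fin S → Fin A → ℝ)
    (obs : ℕ → (Fin H → Fin S × Fin A) → Obs) (sinit : Fin S)
    (ts : Fin K → Fin H → Fin S × Fin A) : ℝ :=
  ∑ k : Fin K, stratValue H (p k) (played alg i obs ts k) (ℓ k) sinit

/-- `E[∑_k V₁^{π^k,p^k,ℓ^k}]`: the expectation, over the algorithm's seed and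
the realized trajectories, of the total value of the selected strategies. -/
noncomputable def algValue {Obs : Type} (H K : ℕ) (alg : Alg S A Obs)
    (p : ℕ → ℕ → Fin S → Fin A → Fin S → ℝ) (ℓ : ℕ → ℕ → Fin S → Fin A → ℝ)
    (obs : ℕ → (Fin H → Fin S × Fin A) → Obs) (sinit : Fin S) : ℝ :=
  ∑' i : ℕ, alg.w i * ∑ ts : Fin K → Fin H → Fin S × Fin A,
    seqProb alg i p obs sinit ts * playedValue H K alg i p ℓ obs sinit ts

/-- The expected regret `E[R_K]` of the algorithm. -/
noncomputable def expRegret {Obs : Type} (H K : ℕ) (alg : Alg S A Obs)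
    (p : ℕ → ℕ → Fin S → Fin A → Fin S → ℝ) (ℓ : ℕ → ℕ → Fin S → Fin A → ℝ)
    (obs : ℕ → (Fin H → Fin S × Fin A) → Obs) (sinit : Fin S) : ℝ :=
  algValue H K alg p ℓ obs sinit - bestValue H K p ℓ sinit

open scoped Classical in
/-- The probability of an event `E` (a predicate of the seed and the realized
trajectories) under the interaction of `alg` with the episodic MDP. -/
noncomputable def eventProb {Obs : Type} (H K : ℕ) (alg : Alg S A Obs)
    (p : ℕ → ℕ → Fin S → Fin A → Fin S → ℝ)
    (obs : ℕ → (Fin H → Fin S × Fin A) → Obs) (sinit : Fin S)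
    (E : ℕ → (Fin K → Fin H → Fin S × Fin A) → Prop) : ℝ :=
  ∑' i : ℕ, alg.w i * ∑ ts : Fin K → Fin H → Fin S × Fin A,
    seqProb alg i p obs sinit ts * (if E i ts then 1 else 0)


/-- Observations with bandit feedback on both losses and transitions: only the
realized trajectory and the losses along it. -/
abbrev BanditObs (S A H : ℕ) : Type :=
  (Fin H → Fin S × Fin A) × (Fin H → ℝ)

/-- The bandit observation map. -/
noncomputable def banditObs {S A : ℕ} (H : ℕ)
    (ℓ : ℕ → ℕ → Fin S → Fin A → ℝ) :
    ℕ → (Fin H → Fin S × Fin A) → BanditObs S A H :=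
  fun k t => (t, fun h => ℓ k h (t h).1 (t h).2)

section SequentialSampling

variable {O : Type*}

/-- The weight of the sequence `ω` when its `k`-th entry is sampled from
`D k` given the previous entries. -/
noncomputable def seqWeight (D : (k : ℕ) → (Fin k → O) → O → ℝ) (K : ℕ) (ω : Fin K → O) : ℝ :=
  ∏ k : Fin K, D k (fun j => ω ⟨(j : ℕ), j.2.trans k.2⟩) (ω k)

lemma seqWeight_snoc (D : (k : ℕ) → (Fin k → O) → O → ℝ) (K : ℕ) (ω : Fin K → O) (o : O) :
    seqWeight D (K + 1) (Fin.snoc (α := fun _ => O) ω o) = seqWeight D K ω * D K ω o := by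
  unfold seqWeight
  rw [Fin.prod_univ_castSucc]
  congr 1
  · refine Finset.prod_congr rfl fun k _ => ?_
    rw [Fin.snoc_castSucc]
    congr 1
    funext j
    have : (⟨(j : ℕ), j.2.trans k.castSucc.2⟩ : Fin (K + 1)) =
        Fin.castSucc ⟨(j : ℕ), j.2.trans k.2⟩ := rfl
    rw [this, Fin.snoc_castSucc]
  · rw [Fin.snoc_last]
    congr 1
    funext j
    have : (⟨(j : ℕ), j.2.trans (Fin.last K).2⟩ : Fin (K + 1)) = Fin.castSucc j := rfl
    rw [this, Fin.snoc_castSucc]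

variable {D : (k : ℕ) → (Fin k → O) → O → ℝ}

lemma seqWeight_nonneg (hD : ∀ k h o, 0 ≤ D k h o) (K : ℕ) (ω : Fin K → O) :
    0 ≤ seqWeight D K ω :=
  Finset.prod_nonneg fun _ _ => hD _ _ _

variable [Fintype O]

lemma sum_fin_succ_snoc {K : ℕ} (F : (Fin (K + 1) → O) → ℝ) :
    ∑ ω, F ω = ∑ ω : Fin K → O, ∑ o, F (Fin.snoc (α := fun _ => O) ω o) := by
  rw [← (Fin.snocEquiv (fun _ : Fin (K + 1) => O)).sum_comp, Fintype.sum_prod_type,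
    Finset.sum_comm]
  rfl

lemma sum_fin_succ_cons {K : ℕ} (F : (Fin (K + 1) → O) → ℝ) :
    ∑ ω, F ω = ∑ o, ∑ ω : Fin K → O, F (Fin.cons (α := fun _ => O) o ω) := by
  rw [← (Fin.consEquiv (fun _ : Fin (K + 1) => O)).sum_comp, Fintype.sum_prod_type]
  rfl

lemma sum_seqWeight (hD : ∀ k h, ∑ o, D k h o = 1) (K : ℕ) :
    ∑ ω : Fin K → O, seqWeight D K ω = 1 := by
  induction K with
  | zero => simp [seqWeight]
  | succ K ih =>
    rw [sum_fin_succ_snoc]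
    simp_rw [seqWeight_snoc, ← Finset.mul_sum, hD, mul_one]
    exact ih

lemma sum_seqWeight_mul_sum (hD : ∀ k h, ∑ o, D k h o = 1)
    (f : (k : ℕ) → (Fin k → O) → O → ℝ) (K : ℕ) :
    ∑ ω : Fin K → O, seqWeight D K ω *
        ∑ k : Fin K, f k (fun j => ω ⟨(j : ℕ), j.2.trans k.2⟩) (ω k) =
      ∑ ω : Fin K → O, seqWeight D K ω *
        ∑ k : Fin K, ∑ o, D k (fun j => ω ⟨(j : ℕ), j.2.trans k.2⟩) o *
          f k (fun j => ω ⟨(j : ℕ), j.2.trans k.2⟩) o := by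
  induction K with
  | zero => simp
  | succ K ih =>
    have key : ∀ (g : (k : ℕ) → (Fin k → O) → O → ℝ) (ω : Fin K → O) (o : O),
        ∑ k : Fin (K + 1), g k (fun j => (Fin.snoc (α := fun _ => O) ω o : Fin (K + 1) → O)
            ⟨(j : ℕ), j.2.trans k.2⟩) ((Fin.snoc (α := fun _ => O) ω o : Fin (K + 1) → O) k) =
          ∑ k : Fin K, g k (fun j => ω ⟨(j : ℕ), j.2.trans k.2⟩) (ω k) + g K ω o := by
      intro g ω o
      rw [Fin.sum_univ_castSucc]
      congr 1
      · refine Finset.sum_congr rfl fun k _ => ?_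
        rw [Fin.snoc_castSucc]
        congr 1
        funext j
        exact Fin.snoc_castSucc (α := fun _ => O) o ω ⟨(j : ℕ), j.2.trans k.2⟩
      · rw [Fin.snoc_last]
        congr 1
        funext j
        exact Fin.snoc_castSucc (α := fun _ => O) o ω j
    rw [sum_fin_succ_snoc, sum_fin_succ_snoc]
    simp_rw [seqWeight_snoc, key f, key (fun k h _ => ∑ o, D k h o * f k h o), mul_add,
      Finset.sum_add_distrib]
    congr 1
    · simp_rw [mul_right_comm _ (D K _ _), ← Finset.mul_sum, hD, mul_one]
      exact ih
    · refine Finset.sum_congr rfl fun ω _ => ?_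
      simp_rw [mul_assoc, ← Finset.mul_sum, ← Finset.sum_mul, hD, one_mul]

lemma sum_seqWeight_mono (hD : ∀ k h, ∑ o, D k h o = 1) (hD0 : ∀ k h o, 0 ≤ D k h o)
    {f g : O → ℝ} (hfg : ∀ k h, ∑ o, D k h o * f o ≤ ∑ o, D k h o * g o) (K : ℕ) :
    ∑ ω : Fin K → O, seqWeight D K ω * ∑ k, f (ω k) ≤
      ∑ ω : Fin K → O, seqWeight D K ω * ∑ k, g (ω k) := by
  rw [sum_seqWeight_mul_sum hD (fun _ _ => f), sum_seqWeight_mul_sum hD (fun _ _ => g)]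
  exact Finset.sum_le_sum fun ω _ => mul_le_mul_of_nonneg_left
    (Finset.sum_le_sum fun k _ => hfg _ _) (seqWeight_nonneg hD0 K ω)

lemma sub_one_le_of_pos {L γ : ℝ} (hL : 0 < L) (hγ : 0 < γ) :
    max (L - 1) 0 ≤ γ + (1 + 1 / γ) * (L - 1 - Real.log L) := by
  have h0 : 0 ≤ L - 1 - Real.log L := by linarith [Real.log_le_sub_one_of_pos hL]
  have hγ' : 0 < 1 / γ := by positivity
  refine max_le ?_ (by positivity)
  set u := √L - 1 with hu
  have hs : √L * √L = L := Real.mul_self_sqrt hL.le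
  have hlog : Real.log L ≤ 2 * u := by
    have := Real.log_le_sub_one_of_pos (Real.sqrt_pos.2 hL)
    rw [Real.log_sqrt hL.le] at this
    linarith
  have hL' : L = (u + 1) * (u + 1) := by rw [hu]; linarith [hs]
  have h1 : u ^ 2 ≤ L - 1 - Real.log L := by nlinarith
  have h2 : 2 * u ≤ γ + (1 / γ) * u ^ 2 := by
    have : γ + (1 / γ) * u ^ 2 - 2 * u = (1 / γ) * (u - γ) ^ 2 := by field_simp; ring
    nlinarith [sq_nonneg (u - γ)]
  nlinarith [mul_le_mul_of_nonneg_left h1 (by positivity : 0 ≤ 1 + 1 / γ)]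

/-- Change of measure: reweighting the one-step laws by `r` changes the mean of a function
with values in `[0, M]` by an amount controlled by the relative entropy. -/
lemma sum_seqWeight_mul_le {D' : (k : ℕ) → (Fin k → O) → O → ℝ} {r : O → ℝ}
    (hr : ∀ o, 0 < r o) (hDD' : ∀ k h o, D' k h o = r o * D k h o)
    (hD : ∀ k h, ∑ o, D k h o = 1) (hD' : ∀ k h, ∑ o, D' k h o = 1)
    (hD0 : ∀ k h o, 0 ≤ D k h o) {K : ℕ} {f : (Fin K → O) → ℝ} {M γ : ℝ} (hγ : 0 < γ)
    (hM : 0 ≤ M) (hf : ∀ ω, 0 ≤ f ω) (hfM : ∀ ω, f ω ≤ M) :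
    ∑ ω, seqWeight D' K ω * f ω ≤ ∑ ω, seqWeight D K ω * f ω +
      M * (γ + (1 + 1 / γ) * ∑ ω, seqWeight D K ω * ∑ k, -Real.log (r (ω k))) := by
  have hL : ∀ ω : Fin K → O, seqWeight D' K ω = seqWeight D K ω * ∏ k, r (ω k) := by
    intro ω
    unfold seqWeight
    simp_rw [hDD', Finset.prod_mul_distrib]
    ring
  have h1 := sum_seqWeight hD K
  have h1' := sum_seqWeight hD' K
  have hpt : ∀ ω : Fin K → O, seqWeight D' K ω * f ω ≤ seqWeight D K ω * f ω +
      M * (γ * seqWeight D K ω + (1 + 1 / γ) * (seqWeight D' K ω - seqWeight D K ω +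
        seqWeight D K ω * ∑ k, -Real.log (r (ω k)))) := by
    intro ω
    have hW := seqWeight_nonneg hD0 K ω
    have hpos : 0 < ∏ k, r (ω k) := Finset.prod_pos fun k _ => hr _
    have hlog : Real.log (∏ k, r (ω k)) = ∑ k, Real.log (r (ω k)) :=
      Real.log_prod fun k _ => (hr _).ne'
    have h2 := sub_one_le_of_pos hpos hγ
    rw [hlog] at h2
    rw [hL]
    set L := ∏ k, r (ω k)
    rw [Finset.sum_neg_distrib]
    have h3 : (L - 1) * f ω ≤ M * max (L - 1) 0 := by
      have := mul_le_mul (le_max_left (L - 1) 0) (hfM ω) (hf ω) (le_max_right (L - 1) 0)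
      linarith
    have h4 := mul_le_mul_of_nonneg_left (h3.trans (mul_le_mul_of_nonneg_left h2 hM)) hW
    linarith
  refine (Finset.sum_le_sum fun ω _ => hpt ω).trans_eq ?_
  rw [Finset.sum_add_distrib, ← Finset.mul_sum, Finset.sum_add_distrib, ← Finset.mul_sum,
    ← Finset.mul_sum, Finset.sum_add_distrib, Finset.sum_sub_distrib, h1, h1']
  ring

end SequentialSampling

section Bandit

/-- The loss recorded by a bit. -/
def bitLoss (x : Bool) : ℝ := if x then 1 else 0

/-- The Bernoulli law with mean `1/2 - ε`. -/
noncomputable def bern (ε : ℝ) (x : Bool) : ℝ := if x then 1 / 2 - ε else 1 / 2 + ε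

lemma bern_nonneg {ε : ℝ} (h0 : 0 ≤ ε) (h1 : ε ≤ 1 / 2) (x : Bool) : 0 ≤ bern ε x := by
  unfold bern; split_ifs <;> linarith

variable {T ι : Type*} [DecidableEq ι]

/-- One round of a stochastic bandit in which every arm has a Bernoulli loss with mean `1/2`,
except that arm `a` has mean `1/2 - ε`. -/
noncomputable def banditStep (arm : T → ι) (q : (k : ℕ) → (Fin k → T × Bool) → T → ℝ)
    (ε : ℝ) (a : ι) (k : ℕ) (h : Fin k → T × Bool) (o : T × Bool) : ℝ :=
  q k h o.1 * bern (if arm o.1 = a then ε else 0) o.2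

variable {arm : T → ι} {q : (k : ℕ) → (Fin k → T × Bool) → T → ℝ}

lemma banditStep_nonneg (hq : ∀ k h t, 0 ≤ q k h t) {ε : ℝ} (h0 : 0 ≤ ε) (h1 : ε ≤ 1 / 2)
    (a : ι) (k : ℕ) (h : Fin k → T × Bool) (o : T × Bool) :
    0 ≤ banditStep arm q ε a k h o := by
  refine mul_nonneg (hq _ _ _) ?_
  split_ifs
  · exact bern_nonneg h0 h1 _
  · exact bern_nonneg le_rfl (by norm_num) _

variable [Fintype T]

lemma sum_banditStep (hq : ∀ k h, ∑ t, q k h t = 1) (ε : ℝ) (a : ι) (k : ℕ)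
    (h : Fin k → T × Bool) : ∑ o, banditStep arm q ε a k h o = 1 := by
  rw [Fintype.sum_prod_type, ← hq k h]
  refine Finset.sum_congr rfl fun t _ => ?_
  simp only [banditStep, bern, Fintype.sum_bool, if_true]
  simp only [Bool.false_eq_true, if_false]
  ring

lemma neg_log_add_neg_log_le {ε : ℝ} (h0 : 0 ≤ ε) (h : ε ^ 2 ≤ 1 / 8) :
    -Real.log (1 - 2 * ε) + -Real.log (1 + 2 * ε) ≤ 8 * ε ^ 2 := by
  have hε : ε < 1 / 2 := by nlinarith
  rw [← neg_add, ← Real.log_mul (by linarith) (by linarith), ← Real.log_inv]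
  have h4 : 0 < 1 - 4 * ε ^ 2 := by linarith
  have e : (1 - 2 * ε) * (1 + 2 * ε) = 1 - 4 * ε ^ 2 := by ring
  rw [e]
  refine (Real.log_le_sub_one_of_pos (inv_pos.2 h4)).trans ?_
  rw [sub_le_iff_le_add, inv_le_iff_one_le_mul₀ h4]
  nlinarith [sq_nonneg ε]

/-- The minimax lower bound for stochastic bandits: averaged over the choice of the good arm,
any adaptive sampling rule misses the good arm in at least a quarter of the rounds. -/
lemma bandit_lower_bound [Fintype ι] (hq0 : ∀ k h t, 0 ≤ q k h t) (hq : ∀ k h, ∑ t, q k h t = 1)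
    {ε : ℝ} (h0 : 0 ≤ ε) (h1 : ε ^ 2 ≤ 1 / 8) (K : ℕ)
    (hK : 288 * ε ^ 2 * K ≤ Fintype.card ι) (hι : 2 ≤ Fintype.card ι) :
    Fintype.card ι * ((1 / 2 - 3 / 4 * ε) * K) ≤
      ∑ a : ι, ∑ ω : Fin K → T × Bool,
        seqWeight (banditStep arm q ε a) K ω * ∑ k, bitLoss (ω k).2 := by
  have hε : ε < 1 / 2 := by nlinarith
  have hnn : ∀ {ε' : ℝ}, 0 ≤ ε' → ε' < 1 / 2 → ∀ a k h o, 0 ≤ banditStep arm q ε' a k h o :=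
    fun h h' => banditStep_nonneg hq0 h h'.le
  obtain ⟨a₀⟩ : Nonempty ι := Fintype.card_pos_iff.1 (by omega)
  set N : ℝ := (Fintype.card ι : ℝ) with hN
  have hN2 : (2 : ℝ) ≤ N := by rw [hN]; exact_mod_cast hι
  set cnt : ι → (Fin K → T × Bool) → ℝ := fun a ω => ∑ k, if arm (ω k).1 = a then 1 else 0
    with hcnt
  have hcnt0 : ∀ a ω, 0 ≤ cnt a ω := fun a ω =>
    Finset.sum_nonneg fun k _ => by split_ifs <;> norm_num
  have hcntK : ∀ a ω, cnt a ω ≤ K := by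
    intro a ω
    calc cnt a ω ≤ ∑ _k : Fin K, (1 : ℝ) :=
          Finset.sum_le_sum fun k _ => by split_ifs <;> norm_num
      _ = K := by simp
  set m : ι → ℝ := fun a => ∑ ω, seqWeight (banditStep arm q 0 a₀) K ω * cnt a ω with hm
  set m' : ι → ℝ := fun a => ∑ ω, seqWeight (banditStep arm q ε a) K ω * cnt a ω with hm'
  have hmsum : ∑ a, m a = K := by
    rw [hm, Finset.sum_comm]
    simp_rw [← Finset.mul_sum]
    have : ∀ ω : Fin K → T × Bool, ∑ a, cnt a ω = K := by
      intro ω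
      simp only [hcnt]
      rw [Finset.sum_comm]
      simp
    simp_rw [this, ← Finset.sum_mul]
    rw [sum_seqWeight (sum_banditStep hq 0 a₀), one_mul]
  have hloss : ∀ a, (1 / 2) * K - ε * m' a ≤ ∑ ω : Fin K → T × Bool,
      seqWeight (banditStep arm q ε a) K ω * ∑ k, bitLoss (ω k).2 := by
    intro a
    have := sum_seqWeight_mono (D := banditStep arm q ε a) (sum_banditStep hq ε a)
      (hnn h0 hε a) (f := fun o => 1 / 2 - ε * if arm o.1 = a then 1 else 0)
      (g := fun o => bitLoss o.2) (fun k h => by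
        rw [Fintype.sum_prod_type, Fintype.sum_prod_type]
        refine Finset.sum_le_sum fun t _ => le_of_eq ?_
        by_cases hh : arm t = a <;> simp [banditStep, bern, bitLoss, hh] <;> ring) K
    refine le_trans (le_of_eq ?_) this
    simp_rw [Finset.sum_sub_distrib, ← Finset.mul_sum, mul_sub, Finset.sum_sub_distrib,
      ← Finset.sum_mul]
    rw [sum_seqWeight (sum_banditStep hq ε a)]
    simp only [hm', hcnt, Finset.mul_sum, Finset.sum_const, Finset.card_univ, Fintype.card_fin]
    simp only [nsmul_eq_mul]
    congr 1
    · ring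
    · refine Finset.sum_congr rfl fun ω _ => Finset.sum_congr rfl fun k _ => by ring
  have hkl : ∀ a, m' a ≤ m a + K * (1 / 8 + 9 * (4 * ε ^ 2 * m a)) := by
    intro a
    have h2 := sum_seqWeight_mul_le (D := banditStep arm q 0 a₀) (D' := banditStep arm q ε a)
      (r := fun o => 2 * bern (if arm o.1 = a then ε else 0) o.2)
      (fun o => by
        have : ∀ x, 0 < bern ε x := fun x => by unfold bern; split_ifs <;> linarith
        have h' : ∀ x, 0 < bern 0 x := fun x => by unfold bern; split_ifs <;> norm_num
        split_ifs
        · linarith [this o.2]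
        · linarith [h' o.2])
      (fun k h o => by simp only [banditStep, bern]; split_ifs <;> ring)
      (sum_banditStep hq 0 a₀) (sum_banditStep hq ε a) (hnn le_rfl (by norm_num) a₀)
      (f := cnt a) (M := K) (γ := 1 / 8) (by norm_num) (by positivity) (hcnt0 a) (hcntK a)
    have h3 := sum_seqWeight_mono (D := banditStep arm q 0 a₀) (sum_banditStep hq 0 a₀)
      (hnn le_rfl (by norm_num) a₀)
      (f := fun o => -Real.log (2 * bern (if arm o.1 = a then ε else 0) o.2))
      (g := fun o => 4 * ε ^ 2 * if arm o.1 = a then 1 else 0) (fun k h => by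
        rw [Fintype.sum_prod_type, Fintype.sum_prod_type]
        refine Finset.sum_le_sum fun t _ => ?_
        by_cases hh : arm t = a
        · have := mul_le_mul_of_nonneg_left (neg_log_add_neg_log_le h0 h1) (hq0 k h t)
          have e1 : 2 * ((1 : ℝ) / 2 - ε) = 1 - 2 * ε := by ring
          have e2 : 2 * ((1 : ℝ) / 2 + ε) = 1 + 2 * ε := by ring
          simp only [banditStep, bern, hh, Fintype.sum_bool, if_true, Bool.false_eq_true,
            if_false, ite_self, e1, e2]
          linarith
        · simp [banditStep, bern, hh]) K
    have h4 : ∑ ω : Fin K → T × Bool, seqWeight (banditStep arm q 0 a₀) K ω *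
        ∑ k, (4 * ε ^ 2 * if arm (ω k).1 = a then 1 else 0) = 4 * ε ^ 2 * m a := by
      simp only [hm, hcnt, ← Finset.mul_sum]
      rw [Finset.mul_sum]
      exact Finset.sum_congr rfl fun ω _ => by ring
    rw [h4] at h3
    refine h2.trans ?_
    have hK0 : (0 : ℝ) ≤ K := by positivity
    have := mul_le_mul_of_nonneg_left h3 hK0
    norm_num at this ⊢
    linarith
  have hsum : ∑ a, m' a ≤ 3 / 4 * K * N := by
    refine (Finset.sum_le_sum fun a _ => hkl a).trans ?_
    simp_rw [mul_add, Finset.sum_add_distrib, ← Finset.mul_sum, hmsum, Finset.sum_const,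
      Finset.card_univ, nsmul_eq_mul, ← hN]
    have hK0 : (0 : ℝ) ≤ K := by positivity
    nlinarith [mul_le_mul_of_nonneg_left hK hK0, mul_le_mul_of_nonneg_left hN2 hK0]
  calc N * ((1 / 2 - 3 / 4 * ε) * K) ≤ ∑ a, ((1 / 2) * K - ε * m' a) := by
        rw [Finset.sum_sub_distrib, ← Finset.mul_sum, ← Finset.mul_sum, Finset.sum_const,
          Finset.card_univ, nsmul_eq_mul, ← hN]
        nlinarith [mul_le_mul_of_nonneg_left hsum h0]
    _ ≤ _ := Finset.sum_le_sum fun a _ => hloss a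

end Bandit

section Trajectories

variable {p : ℕ → Fin S → Fin A → Fin S → ℝ} {σ : List (Fin S × Fin A) → Fin S → Fin A → ℝ}

lemma trajProb_singleton (h : ℕ) (s : Fin S) (hist : List (Fin S × Fin A)) (o : Fin S × Fin A) :
    trajProb p σ h s hist [o] = if o.1 = s then σ hist s o.2 else 0 := by
  obtain ⟨s', a⟩ := o
  rw [trajProb]

lemma trajProb_cons_ofFn {n : ℕ} (h : ℕ) (s : Fin S) (hist : List (Fin S × Fin A))
    (o : Fin S × Fin A) (t : Fin (n + 1) → Fin S × Fin A) :
    trajProb p σ h s hist (o :: List.ofFn t) =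
      (if o.1 = s then σ hist s o.2 else 0) * p h o.1 o.2 (t 0).1 *
        trajProb p σ (h + 1) (t 0).1 (hist ++ [o]) (List.ofFn t) := by
  obtain ⟨s', a⟩ := o
  rw [List.ofFn_succ]
  generalize t 0 = o'
  obtain ⟨s'', a''⟩ := o'
  rw [trajProb]

lemma ofFn_cons {n : ℕ} {X : Type*} (o : X) (t : Fin n → X) :
    List.ofFn (Fin.cons (α := fun _ => X) o t : Fin (n + 1) → X) = o :: List.ofFn t := by
  rw [List.ofFn_succ]
  simp

lemma trajProb_eq_zero {n : ℕ} {h : ℕ} {s : Fin S} {hist : List (Fin S × Fin A)}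
    {t : Fin (n + 1) → Fin S × Fin A} (ht : (t 0).1 ≠ s) :
    trajProb p σ h s hist (List.ofFn t) = 0 := by
  rw [List.ofFn_succ]
  cases n with
  | zero => simp [trajProb_singleton, ht]
  | succ n => rw [trajProb_cons_ofFn]; simp [ht]

lemma trajProb_nonneg (hp : ∀ h, IsKernel (p h)) (hσ : IsStrategy σ) (h : ℕ) (s : Fin S)
    (hist : List (Fin S × Fin A)) {n : ℕ} (t : Fin (n + 1) → Fin S × Fin A) :
    0 ≤ trajProb p σ h s hist (List.ofFn t) := by
  induction n generalizing h s hist with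
  | zero =>
    simp only [List.ofFn_succ, List.ofFn_zero, trajProb_singleton]
    split_ifs
    · exact hσ.1 _ _ _
    · exact le_rfl
  | succ n ih =>
    rw [List.ofFn_succ, trajProb_cons_ofFn]
    refine mul_nonneg (mul_nonneg ?_ ((hp h).1 _ _ _)) (ih _ _ _ _)
    split_ifs
    · exact hσ.1 _ _ _
    · exact le_rfl

lemma sum_ite_strategy (hσ : IsStrategy σ) (hist : List (Fin S × Fin A)) (s : Fin S) :
    ∑ o : Fin S × Fin A, (if o.1 = s then σ hist s o.2 else 0) = 1 := by
  rw [Fintype.sum_prod_type, Finset.sum_eq_single s]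
  · simpa using hσ.2 hist s
  · intro b _ hb
    simp [hb]
  · simp

lemma sum_trajProb (hp : ∀ h, IsKernel (p h)) (hσ : IsStrategy σ) (n h : ℕ) (s : Fin S)
    (hist : List (Fin S × Fin A)) :
    ∑ t : Fin (n + 1) → Fin S × Fin A, trajProb p σ h s hist (List.ofFn t) = 1 := by
  induction n generalizing h s hist with
  | zero =>
    rw [sum_fin_succ_cons]
    simp only [ofFn_cons, List.ofFn_zero, trajProb_singleton]
    simpa using sum_ite_strategy hσ hist s
  | succ n ih =>
    rw [sum_fin_succ_cons, ← sum_ite_strategy hσ hist s]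
    refine Finset.sum_congr rfl fun o _ => ?_
    simp_rw [ofFn_cons, trajProb_cons_ofFn, mul_assoc, ← Finset.mul_sum]
    have key : ∀ t : Fin (n + 1) → Fin S × Fin A,
        p h o.1 o.2 (t 0).1 * trajProb p σ (h + 1) (t 0).1 (hist ++ [o]) (List.ofFn t) =
          ∑ s', p h o.1 o.2 s' * trajProb p σ (h + 1) s' (hist ++ [o]) (List.ofFn t) := by
      intro t
      rw [Finset.sum_eq_single (t 0).1]
      · intro b _ hb
        rw [trajProb_eq_zero hb.symm, mul_zero]
      · simp
    simp_rw [key]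
    rw [Finset.sum_comm]
    simp_rw [← Finset.mul_sum, ih, mul_one, (hp h).2]
    rw [mul_one]

lemma trajProb_eq_mul_prod {n : ℕ} (h : ℕ) (s : Fin S) (hist : List (Fin S × Fin A))
    (t : Fin (n + 1) → Fin S × Fin A) :
    trajProb p σ h s hist (List.ofFn t) =
      trajProb (fun _ _ _ _ => 1) σ h s hist (List.ofFn t) *
        ∏ j : Fin n, p (h + j) (t j.castSucc).1 (t j.castSucc).2 (t j.succ).1 := by
  induction n generalizing h s hist with
  | zero => simp [List.ofFn_succ, trajProb_singleton]
  | succ n ih =>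
    rw [List.ofFn_succ, trajProb_cons_ofFn, trajProb_cons_ofFn, ih, Fin.prod_univ_succ]
    have : ∀ j : Fin n, h + 1 + (j : ℕ) = h + (j.succ : ℕ) := fun j => by
      rw [Fin.val_succ]; ring
    simp_rw [this]
    simp only [Fin.castSucc_zero, Fin.val_zero, add_zero, Fin.succ_castSucc]
    ring

end Trajectories

section Lock

variable {n : ℕ}

/-- The hidden good state at each step: the initial state, followed by the labels `g`. -/
def goodState (s₀ : Fin 2) (g : Fin n → Fin 2) : ℕ → Fin 2
  | 0 => s₀
  | h + 1 => if hh : h < n then g ⟨h, hh⟩ else 0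

/-- The combination-lock transitions: the good state is kept only by playing the next action of
the code `c`. -/
def lockTrans (c : Fin (n + 1) → Fin A) (s₀ : Fin 2) (g : Fin n → Fin 2)
    (h : ℕ) (s : Fin 2) (a : Fin A) (s' : Fin 2) : ℝ :=
  if s' = (if s = goodState s₀ g h ∧ a = c (Fin.ofNat (n + 1) h) then goodState s₀ g (h + 1)
    else 1 + goodState s₀ g (h + 1)) then 1 else 0

/-- The loss bit of an episode: the first bit of `x` if the last step completes the code in the
good state, and the second bit otherwise. -/
def lockBit (c : Fin (n + 1) → Fin A) (s₀ : Fin 2) (g : Fin n → Fin 2) (x : Bool × Bool)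
    (s : Fin 2) (a : Fin A) : Bool :=
  if s = goodState s₀ g n ∧ a = c (Fin.last n) then x.1 else x.2

/-- The combination-lock loss, incurred at the last step only. -/
def lockLoss (c : Fin (n + 1) → Fin A) (s₀ : Fin 2) (g : Fin n → Fin 2) (x : Bool × Bool)
    (h : ℕ) (s : Fin 2) (a : Fin A) : ℝ :=
  if h = n then bitLoss (lockBit c s₀ g x s a) else 0

lemma bitLoss_nonneg (x : Bool) : 0 ≤ bitLoss x := by unfold bitLoss; split_ifs <;> norm_num

lemma bitLoss_le_one (x : Bool) : bitLoss x ≤ 1 := by unfold bitLoss; split_ifs <;> norm_num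

lemma isKernel_lockTrans (c : Fin (n + 1) → Fin A) (s₀ : Fin 2) (g : Fin n → Fin 2) (h : ℕ) :
    IsKernel (lockTrans c s₀ g h) := by
  refine ⟨fun s a s' => ?_, fun s a => ?_⟩
  · unfold lockTrans; split_ifs <;> norm_num
  · simp [lockTrans]

lemma lockLoss_nonneg (c : Fin (n + 1) → Fin A) (s₀ : Fin 2) (g : Fin n → Fin 2)
    (x : Bool × Bool) (h : ℕ) (s : Fin 2) (a : Fin A) : 0 ≤ lockLoss c s₀ g x h s a := by
  unfold lockLoss
  split_ifs
  exacts [bitLoss_nonneg _, le_rfl]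

lemma lockLoss_le_one (c : Fin (n + 1) → Fin A) (s₀ : Fin 2) (g : Fin n → Fin 2)
    (x : Bool × Bool) (h : ℕ) (s : Fin 2) (a : Fin A) : lockLoss c s₀ g x h s a ≤ 1 := by
  unfold lockLoss
  split_ifs
  exacts [bitLoss_le_one _, zero_le_one]

lemma trajLoss_lockLoss (c : Fin (n + 1) → Fin A) (s₀ : Fin 2) (g : Fin n → Fin 2)
    (x : Bool × Bool) (t : Fin (n + 1) → Fin 2 × Fin A) :
    trajLoss (n + 1) (lockLoss c s₀ g x) t =
      bitLoss (lockBit c s₀ g x (t (Fin.last n)).1 (t (Fin.last n)).2) := by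
  unfold trajLoss
  rw [Fin.sum_univ_castSucc, Finset.sum_eq_zero]
  · simp [lockLoss]
  · intro j _
    simp [lockLoss, j.2.ne]

lemma one_add_ne (s : Fin 2) : 1 + s ≠ s := by fin_cases s <;> decide

lemma eq_one_add_of_ne {s s' : Fin 2} (h : s ≠ s') : s = 1 + s' := by
  fin_cases s <;> fin_cases s' <;> simp_all

/-- Under lock transitions, the state is good iff the code has been followed so far. -/
lemma eq_goodState_iff {c : Fin (n + 1) → Fin A} {s₀ : Fin 2} {g : Fin n → Fin 2}
    {t : Fin (n + 1) → Fin 2 × Fin A} (h0 : (t 0).1 = s₀)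
    (ht : ∀ j : Fin n, (t j.succ).1 =
      if (t j.castSucc).1 = goodState s₀ g j ∧ (t j.castSucc).2 = c j.castSucc
        then goodState s₀ g (j + 1) else 1 + goodState s₀ g (j + 1)) (h : Fin (n + 1)) :
    (t h).1 = goodState s₀ g h ↔ ∀ j, j < h → (t j).2 = c j := by
  induction h using Fin.induction with
  | zero => simp [h0, goodState]
  | succ h ih =>
    rw [ht h, Fin.val_succ]
    have : (∀ j, j < h.succ → (t j).2 = c j) ↔
        (∀ j, j < h.castSucc → (t j).2 = c j) ∧ (t h.castSucc).2 = c h.castSucc := by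
      constructor
      · exact fun H => ⟨fun j hj => H j (hj.trans h.castSucc_lt_succ), H _ h.castSucc_lt_succ⟩
      · rintro ⟨H, H'⟩ j hj
        rcases (Fin.le_castSucc_iff.2 hj).lt_or_eq with h' | h'
        · exact H j h'
        · rw [h']; exact H'
    rw [this, ← ih]
    simp only [Fin.val_castSucc]
    split_ifs with hc
    · exact ⟨fun _ => hc, fun _ => rfl⟩
    · exact ⟨fun H => absurd H (one_add_ne _), fun H => absurd H hc⟩

/-- Exactly one labelling of the states is consistent with a given trajectory. -/
lemma sum_prod_lockTrans (c : Fin (n + 1) → Fin A) (s₀ : Fin 2)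
    (t : Fin (n + 1) → Fin 2 × Fin A) (h0 : (t 0).1 = s₀) (x : Bool × Bool) (F : Bool → ℝ) :
    ∑ g : Fin n → Fin 2,
      (∏ j : Fin n, lockTrans c s₀ g j (t j.castSucc).1 (t j.castSucc).2 (t j.succ).1) *
        F (lockBit c s₀ g x (t (Fin.last n)).1 (t (Fin.last n)).2) =
      F (if (fun h => (t h).2) = c then x.1 else x.2) := by
  classical
  have hof : ∀ j : Fin n, Fin.ofNat (n + 1) (j : ℕ) = j.castSucc := fun j => by
    ext; simp
  have hprod : ∀ g : Fin n → Fin 2,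
      (∏ j : Fin n, lockTrans c s₀ g j (t j.castSucc).1 (t j.castSucc).2 (t j.succ).1) =
        if ∀ j : Fin n, (t j.succ).1 =
          if (t j.castSucc).1 = goodState s₀ g j ∧ (t j.castSucc).2 = c j.castSucc
            then goodState s₀ g (j + 1) else 1 + goodState s₀ g (j + 1) then 1 else 0 := by
    intro g
    simp only [lockTrans, hof]
    rw [Finset.prod_boole]
    simp
  have hgs : ∀ (g : Fin n → Fin 2) (j : Fin n), goodState s₀ g (j + 1) = g j := fun g j => by
    simp [goodState]
  set g₀ : Fin n → Fin 2 := fun j =>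
    if ∀ i, i < j.succ → (t i).2 = c i then (t j.succ).1 else 1 + (t j.succ).1 with hg₀
  have hmatch : ∀ h : Fin (n + 1),
      (t h).1 = goodState s₀ g₀ h ↔ ∀ j, j < h → (t j).2 = c j := by
    intro h
    cases h using Fin.cases with
    | zero => simp [h0, goodState]
    | succ j =>
      rw [Fin.val_succ, hgs]
      simp only [hg₀]
      split_ifs with hc
      · exact ⟨fun _ => hc, fun _ => rfl⟩
      · exact ⟨fun H => absurd H.symm (one_add_ne _), fun H => absurd H hc⟩
  have hg₀ok : ∀ j : Fin n, (t j.succ).1 =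
      if (t j.castSucc).1 = goodState s₀ g₀ j ∧ (t j.castSucc).2 = c j.castSucc
        then goodState s₀ g₀ (j + 1) else 1 + goodState s₀ g₀ (j + 1) := by
    intro j
    have h1 := hmatch j.castSucc
    have h2 := hmatch j.succ
    rw [Fin.val_castSucc] at h1
    rw [Fin.val_succ] at h2
    split_ifs with hc
    · rw [h2]
      intro i hi
      rcases (Fin.le_castSucc_iff.2 hi).lt_or_eq with h' | h'
      · exact h1.1 hc.1 i h'
      · rw [h']; exact hc.2
    · refine eq_one_add_of_ne fun H => hc ?_
      have := h2.1 H
      exact ⟨h1.2 fun i hi => this i (hi.trans j.castSucc_lt_succ), this _ j.castSucc_lt_succ⟩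
  rw [Finset.sum_eq_single g₀]
  · rw [hprod, if_pos hg₀ok, one_mul]
    congr 1
    unfold lockBit
    have h1 := hmatch (Fin.last n)
    rw [Fin.val_last] at h1
    have : (fun h => (t h).2) = c ↔
        (t (Fin.last n)).1 = goodState s₀ g₀ n ∧ (t (Fin.last n)).2 = c (Fin.last n) := by
      rw [h1, funext_iff]
      refine ⟨fun H => ⟨fun j _ => H j, H _⟩, fun H j => ?_⟩
      rcases (Fin.le_last j).lt_or_eq with h' | h'
      · exact H.1 j h'
      · rw [h']; exact H.2
    simp only [this]
  · intro g _ hg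
    rw [hprod, if_neg, zero_mul]
    intro H
    apply hg
    funext j
    have h1 := eq_goodState_iff h0 H j.succ
    rw [Fin.val_succ, hgs] at h1
    simp only [hg₀]
    split_ifs with hc
    · exact (h1.2 hc).symm
    · exact eq_one_add_of_ne fun h' => hc (h1.1 h'.symm)
  · simp

/-- The law of the labels and loss bits of one episode. -/
noncomputable def lockLaw (n : ℕ) (ε : ℝ) (β : (Fin n → Fin 2) × Bool × Bool) : ℝ :=
  (1 / 2) ^ n * (bern ε β.2.1 * bern 0 β.2.2)

lemma lockLaw_nonneg {ε : ℝ} (h0 : 0 ≤ ε) (h1 : ε ≤ 1 / 2)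
    (β : (Fin n → Fin 2) × Bool × Bool) : 0 ≤ lockLaw n ε β :=
  mul_nonneg (by positivity) (mul_nonneg (bern_nonneg h0 h1 _)
    (bern_nonneg le_rfl (by norm_num) _))

lemma sum_lockLaw_mul (n : ℕ) (ε : ℝ) (F : Bool → ℝ) :
    ∑ β, lockLaw n ε β * F β.2.1 = (1 / 2 - ε) * F true + (1 / 2 + ε) * F false := by
  simp only [lockLaw, Fintype.sum_prod_type, Fintype.sum_bool, bern, if_true, Bool.false_eq_true,
    if_false, Finset.sum_const, Finset.card_univ, Fintype.card_fun, Fintype.card_fin,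
    nsmul_eq_mul]
  have : ((2 ^ n : ℕ) : ℝ) * (1 / 2) ^ n = 1 := by
    push_cast; rw [← mul_pow]; norm_num
  linear_combination ((1 / 2 - ε) * F true + (1 / 2 + ε) * F false) * this

/-- The uniform transitions. -/
noncomputable def unifTrans (A : ℕ) (_ : ℕ) (_ : Fin 2) (_ : Fin A) (_ : Fin 2) : ℝ := 1 / 2

lemma isKernel_unifTrans (h : ℕ) : IsKernel (unifTrans A h) :=
  ⟨fun _ _ _ => by norm_num [unifTrans], fun _ _ => by simp [unifTrans]⟩

/-- Averaged over labels and loss bits, one lock episode is one round of a bandit whose arms are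
the action sequences. -/
lemma sum_lockLaw_mul_trajDist (c : Fin (n + 1) → Fin A) (s₀ : Fin 2) (ε : ℝ)
    (σ : List (Fin 2 × Fin A) → Fin 2 → Fin A → ℝ) (t : Fin (n + 1) → Fin 2 × Fin A) (x : Bool) :
    ∑ β with lockBit c s₀ β.1 β.2 (t (Fin.last n)).1 (t (Fin.last n)).2 = x,
        lockLaw n ε β * trajDist (n + 1) (lockTrans c s₀ β.1) σ s₀ t =
      trajDist (n + 1) (unifTrans A) σ s₀ t *
        bern (if (fun h => (t h).2) = c then ε else 0) x := by
  unfold trajDist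
  rw [Finset.sum_filter]
  by_cases h0 : (t 0).1 = s₀
  · have hu : trajProb (unifTrans A) σ 0 s₀ [] (List.ofFn t) =
        trajProb (fun _ _ _ _ => 1) σ 0 s₀ [] (List.ofFn t) * (1 / 2) ^ n := by
      rw [trajProb_eq_mul_prod]; simp [unifTrans]
    set P := trajProb (fun _ _ _ _ => 1) σ 0 s₀ [] (List.ofFn t)
    have hterm : ∀ (g : Fin n → Fin 2) (y : Bool × Bool),
        (if lockBit c s₀ g y (t (Fin.last n)).1 (t (Fin.last n)).2 = x then
          lockLaw n ε (g, y) * trajProb (lockTrans c s₀ g) σ 0 s₀ [] (List.ofFn t) else 0) =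
        (1 / 2) ^ n * P * (bern ε y.1 * bern 0 y.2) *
          ((∏ j : Fin n, lockTrans c s₀ g j (t j.castSucc).1 (t j.castSucc).2 (t j.succ).1) *
            (fun b : Bool => if b = x then (1 : ℝ) else 0)
              (lockBit c s₀ g y (t (Fin.last n)).1 (t (Fin.last n)).2)) := by
      intro g y
      rw [trajProb_eq_mul_prod]
      simp only [lockLaw, zero_add]
      split_ifs
      · ring
      · ring
    rw [Fintype.sum_prod_type, Finset.sum_comm, hu]
    simp only [hterm, ← Finset.mul_sum]
    have hs : ∀ y : Bool × Bool, _ := fun y => sum_prod_lockTrans c s₀ t h0 y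
      (fun b : Bool => if b = x then (1 : ℝ) else 0)
    simp only [hs, Fintype.sum_prod_type, Fintype.sum_bool]
    by_cases hc : (fun h => (t h).2) = c <;> cases x <;> simp [hc, bern] <;> ring
  · rw [trajProb_eq_zero h0, zero_mul]
    refine Finset.sum_eq_zero fun β _ => ?_
    rw [trajProb_eq_zero h0, mul_zero, ite_self]

end Lock

section Comparator

variable {n : ℕ}

lemma stateDist_nonneg {p : ℕ → Fin S → Fin A → Fin S → ℝ} {π : ℕ → Fin S → Fin A → ℝ}
    (hp : ∀ h, IsKernel (p h)) (hπ : IsPolicy π) (s₀ : Fin S) (h : ℕ) (s : Fin S) :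
    0 ≤ stateDist p π s₀ h s := by
  induction h generalizing s with
  | zero => simp only [stateDist]; split_ifs <;> norm_num
  | succ h ih =>
    exact Finset.sum_nonneg fun s' _ => Finset.sum_nonneg fun a _ =>
      mul_nonneg (mul_nonneg (ih s') (hπ.1 _ _ _)) ((hp h).1 _ _ _)

lemma bestValue_le {H K : ℕ} {p : ℕ → ℕ → Fin S → Fin A → Fin S → ℝ}
    {ℓ : ℕ → ℕ → Fin S → Fin A → ℝ} {s₀ : Fin S} (hp : ∀ k h, IsKernel (p k h))
    (hℓ : ∀ k h s a, 0 ≤ ℓ k h s a) {π : ℕ → Fin S → Fin A → ℝ} (hπ : IsPolicy π) :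
    bestValue H K p ℓ s₀ ≤ ∑ k ∈ range K, value H (p k) π (ℓ k) s₀ := by
  refine csInf_le ⟨0, ?_⟩ ⟨π, hπ, rfl⟩
  rintro x ⟨π', hπ', rfl⟩
  exact Finset.sum_nonneg fun k _ => Finset.sum_nonneg fun h _ => Finset.sum_nonneg fun s _ =>
    Finset.sum_nonneg fun a _ => mul_nonneg
      (mul_nonneg (stateDist_nonneg (hp k) hπ' s₀ h s) (hπ'.1 _ _ _)) (hℓ _ _ _ _)

/-- The policy that plays the code `c` in every state. -/
def codePolicy (c : Fin (n + 1) → Fin A) (h : ℕ) (_ : Fin 2) (a : Fin A) : ℝ :=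
  if a = c (Fin.ofNat (n + 1) h) then 1 else 0

lemma isPolicy_codePolicy (c : Fin (n + 1) → Fin A) : IsPolicy (codePolicy c) := by
  refine ⟨fun h s a => ?_, fun h s => ?_⟩
  · unfold codePolicy; split_ifs <;> norm_num
  · simp [codePolicy]

lemma stateDist_codePolicy (c : Fin (n + 1) → Fin A) (s₀ : Fin 2) (g : Fin n → Fin 2) (h : ℕ)
    (s : Fin 2) : stateDist (lockTrans c s₀ g) (codePolicy c) s₀ h s =
      if s = goodState s₀ g h then 1 else 0 := by
  induction h generalizing s with
  | zero => rfl
  | succ h ih =>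
    simp only [stateDist, ih]
    rw [Finset.sum_eq_single (goodState s₀ g h), Finset.sum_eq_single (c (Fin.ofNat (n + 1) h))]
    · simp [codePolicy, lockTrans]
    · intro a _ ha
      rw [codePolicy, if_neg ha, mul_zero, zero_mul]
    · simp
    · intro s' _ hs'
      simp [hs']
    · simp

lemma value_codePolicy (c : Fin (n + 1) → Fin A) (s₀ : Fin 2) (g : Fin n → Fin 2)
    (x : Bool × Bool) :
    value (n + 1) (lockTrans c s₀ g) (codePolicy c) (lockLoss c s₀ g x) s₀ = bitLoss x.1 := by
  unfold value
  rw [Finset.sum_eq_single n]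
  · simp only [stateDist_codePolicy]
    rw [Finset.sum_eq_single (goodState s₀ g n), Finset.sum_eq_single (c (Fin.last n))]
    · simp [codePolicy, lockLoss, lockBit]
    · intro a _ ha
      simp [codePolicy, ha]
    · simp
    · intro s' _ hs'
      simp [hs']
    · simp
  · intro h _ hh
    simp [lockLoss, hh]
  · simp

end Comparator

section Interaction

lemma trajDist_nonneg {n : ℕ} {p : ℕ → Fin S → Fin A → Fin S → ℝ}
    {σ : List (Fin S × Fin A) → Fin S → Fin A → ℝ} (hp : ∀ h, IsKernel (p h))
    (hσ : IsStrategy σ) (s₀ : Fin S) (t : Fin (n + 1) → Fin S × Fin A) :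
    0 ≤ trajDist (n + 1) p σ s₀ t :=
  trajProb_nonneg hp hσ _ _ _ _

lemma sum_trajDist {n : ℕ} {p : ℕ → Fin S → Fin A → Fin S → ℝ}
    {σ : List (Fin S × Fin A) → Fin S → Fin A → ℝ} (hp : ∀ h, IsKernel (p h))
    (hσ : IsStrategy σ) (s₀ : Fin S) :
    ∑ t : Fin (n + 1) → Fin S × Fin A, trajDist (n + 1) p σ s₀ t = 1 :=
  sum_trajProb hp hσ _ _ _ _

variable {Obs : Type} {n K : ℕ} {p : ℕ → ℕ → Fin S → Fin A → Fin S → ℝ}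

lemma seqProb_nonneg (alg : Alg S A Obs) (i : ℕ) (hp : ∀ k h, IsKernel (p k h))
    (obs : ℕ → (Fin (n + 1) → Fin S × Fin A) → Obs) (s₀ : Fin S)
    (ts : Fin K → Fin (n + 1) → Fin S × Fin A) :
    0 ≤ seqProb alg i p obs s₀ ts :=
  Finset.prod_nonneg fun k _ => trajDist_nonneg (hp k) (alg.act_strat _ _) _ _

lemma sum_seqProb (alg : Alg S A Obs) (i : ℕ) (hp : ∀ k h, IsKernel (p k h))
    (obs : ℕ → (Fin (n + 1) → Fin S × Fin A) → Obs) (s₀ : Fin S) :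
    ∑ ts : Fin K → Fin (n + 1) → Fin S × Fin A, seqProb alg i p obs s₀ ts = 1 :=
  sum_seqWeight (D := fun k h t => trajDist (n + 1) (p k)
    (alg.act i (List.ofFn fun j : Fin k => obs j (h j))) s₀ t)
    (fun k _ => sum_trajDist (hp k) (alg.act_strat _ _) s₀) K

/-- The expected value of the selected strategies is the expected realized loss. -/
lemma sum_seqProb_mul_playedValue (alg : Alg S A Obs) (i : ℕ) (hp : ∀ k h, IsKernel (p k h))
    (ℓ : ℕ → ℕ → Fin S → Fin A → ℝ) (obs : ℕ → (Fin (n + 1) → Fin S × Fin A) → Obs) (s₀ : Fin S) :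
    ∑ ts : Fin K → Fin (n + 1) → Fin S × Fin A,
        seqProb alg i p obs s₀ ts * playedValue (n + 1) K alg i p ℓ obs s₀ ts =
      ∑ ts : Fin K → Fin (n + 1) → Fin S × Fin A,
        seqProb alg i p obs s₀ ts * ∑ k : Fin K, trajLoss (n + 1) (ℓ k) (ts k) :=
  (sum_seqWeight_mul_sum (D := fun k h t => trajDist (n + 1) (p k)
    (alg.act i (List.ofFn fun j : Fin k => obs j (h j))) s₀ t)
    (fun k _ => sum_trajDist (hp k) (alg.act_strat _ _) s₀)
    (fun k _ t => trajLoss (n + 1) (ℓ k) t) K).symm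

end Interaction

section Mixture

variable {n K : ℕ}

/-- The labels and loss bits of episode `k`. -/
def lockSeed (β : Fin K → (Fin n → Fin 2) × Bool × Bool) (k : ℕ) :
    (Fin n → Fin 2) × Bool × Bool :=
  if h : k < K then β ⟨k, h⟩ else default

/-- The transitions of the lock instance with seed `β`. -/
def lockInstTrans (c : Fin (n + 1) → Fin A) (s₀ : Fin 2)
    (β : Fin K → (Fin n → Fin 2) × Bool × Bool) (k : ℕ) : ℕ → Fin 2 → Fin A → Fin 2 → ℝ :=
  lockTrans c s₀ (lockSeed β k).1

/-- The losses of the lock instance with seed `β`. -/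
def lockInstLoss (c : Fin (n + 1) → Fin A) (s₀ : Fin 2)
    (β : Fin K → (Fin n → Fin 2) × Bool × Bool) (k : ℕ) : ℕ → Fin 2 → Fin A → ℝ :=
  lockLoss c s₀ (lockSeed β k).1 (lockSeed β k).2

lemma lockSeed_val (β : Fin K → (Fin n → Fin 2) × Bool × Bool) (k : Fin K) :
    lockSeed β k = β k := by
  simp [lockSeed]

/-- The feedback of a lock episode with trajectory `o.1` and final loss bit `o.2`. -/
def lockObs (o : (Fin (n + 1) → Fin 2 × Fin A) × Bool) : BanditObs 2 A (n + 1) :=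
  (o.1, fun h => if (h : ℕ) = n then bitLoss o.2 else 0)

lemma banditObs_lockInstLoss (c : Fin (n + 1) → Fin A) (s₀ : Fin 2)
    (β : Fin K → (Fin n → Fin 2) × Bool × Bool) (k : Fin K) (t : Fin (n + 1) → Fin 2 × Fin A) :
    banditObs (n + 1) (lockInstLoss c s₀ β) k t =
      lockObs (t, lockBit c s₀ (β k).1 (β k).2 (t (Fin.last n)).1 (t (Fin.last n)).2) := by
  unfold banditObs lockObs lockInstLoss lockLoss
  rw [lockSeed_val]
  congr 1
  funext h
  by_cases hh : (h : ℕ) = n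
  · have : h = Fin.last n := Fin.ext hh
    subst this
    rfl
  · simp [hh]

/-- The distribution of the trajectory of episode `k` under uniform transitions, given the
feedback of the previous episodes. -/
noncomputable def unifStep (alg : Alg 2 A (BanditObs 2 A (n + 1))) (i : ℕ) (s₀ : Fin 2) (k : ℕ)
    (h : Fin k → (Fin (n + 1) → Fin 2 × Fin A) × Bool) (t : Fin (n + 1) → Fin 2 × Fin A) : ℝ :=
  trajDist (n + 1) (unifTrans A) (alg.act i (List.ofFn fun j => lockObs (h j))) s₀ t

/-- Averaged over seeds, interacting with the lock instances is playing a bandit whose arms are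
the action sequences. -/
lemma sum_lock_eq_sum_bandit (alg : Alg 2 A (BanditObs 2 A (n + 1))) (i : ℕ) (s₀ : Fin 2)
    (ε : ℝ) (c : Fin (n + 1) → Fin A) :
    ∑ β : Fin K → (Fin n → Fin 2) × Bool × Bool, (∏ k, lockLaw n ε (β k)) *
        ∑ ts : Fin K → Fin (n + 1) → Fin 2 × Fin A,
          seqProb alg i (lockInstTrans c s₀ β) (banditObs (n + 1) (lockInstLoss c s₀ β)) s₀ ts *
            playedValue (n + 1) K alg i (lockInstTrans c s₀ β) (lockInstLoss c s₀ β)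
              (banditObs (n + 1) (lockInstLoss c s₀ β)) s₀ ts =
      ∑ ω : Fin K → (Fin (n + 1) → Fin 2 × Fin A) × Bool,
        seqWeight (banditStep (fun t h => (t h).2) (unifStep alg i s₀) ε c) K ω *
          ∑ k, bitLoss (ω k).2 := by
  classical
  have hp : ∀ (β : Fin K → (Fin n → Fin 2) × Bool × Bool) k h,
      IsKernel (lockInstTrans c s₀ β k h) := fun β k h => isKernel_lockTrans _ _ _ _
  simp_rw [fun β => sum_seqProb_mul_playedValue alg i (hp β) (K := K) (lockInstLoss c s₀ β)
    (banditObs (n + 1) (lockInstLoss c s₀ β)) s₀, Finset.mul_sum _ _ (∏ k, lockLaw n ε _)]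
  rw [Finset.sum_comm, ← (Equiv.arrowProdEquivProdArrow (Fin K) (fun _ =>
    Fin (n + 1) → Fin 2 × Fin A) (fun _ => Bool)).symm.sum_comp, Fintype.sum_prod_type]
  refine Finset.sum_congr rfl fun ts _ => ?_
  let bits : (Fin K → (Fin n → Fin 2) × Bool × Bool) → Fin K → Bool := fun β k =>
    lockBit c s₀ (β k).1 (β k).2 (ts k (Fin.last n)).1 (ts k (Fin.last n)).2
  rw [← Finset.sum_fiberwise (Finset.univ) bits]
  refine Finset.sum_congr rfl fun x _ => ?_
  have hset : (Finset.univ.filter fun β => bits β = x) = Fintype.piFinset fun k =>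
      Finset.univ.filter fun β : (Fin n → Fin 2) × Bool × Bool =>
        lockBit c s₀ β.1 β.2 (ts k (Fin.last n)).1 (ts k (Fin.last n)).2 = x k := by
    ext β
    simp [bits, Fintype.mem_piFinset, funext_iff]
  have hω : ∀ k, (Equiv.arrowProdEquivProdArrow (Fin K) (fun _ =>
    Fin (n + 1) → Fin 2 × Fin A) (fun _ => Bool)).symm (ts, x) k = (ts k, x k) := fun _ => rfl
  unfold seqWeight
  simp only [hω, banditStep, unifStep, ← sum_lockLaw_mul_trajDist]
  rw [Finset.prod_univ_sum, Finset.sum_mul, hset]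
  refine Finset.sum_congr rfl fun β hβ => ?_
  have hβ' : ∀ k, lockBit c s₀ (β k).1 (β k).2 (ts k (Fin.last n)).1 (ts k (Fin.last n)).2 =
      x k := fun k => by simpa using Fintype.mem_piFinset.1 hβ k
  rw [← mul_assoc]
  unfold seqProb
  rw [← Finset.prod_mul_distrib]
  congr 1
  · refine Finset.prod_congr rfl fun k _ => ?_
    congr 1
    unfold played lockInstTrans
    rw [lockSeed_val]
    congr 2
    refine congrArg List.ofFn (funext fun j => ?_)
    rw [← hβ' ⟨(j : ℕ), j.2.trans k.2⟩]
    exact banditObs_lockInstLoss c s₀ β ⟨(j : ℕ), j.2.trans k.2⟩ _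
  · refine Finset.sum_congr rfl fun k _ => ?_
    unfold lockInstLoss
    rw [lockSeed_val, trajLoss_lockLoss, hβ']

/-- A finite mixture can be indexed by the natural numbers. -/
lemma exists_nat_mixture {Ω X : Type*} [Fintype Ω] [Nonempty Ω] {m : Ω → ℝ} (hm : ∀ ω, 0 ≤ m ω)
    (hm1 : ∑ ω, m ω = 1) (x : Ω → X) :
    ∃ (ν : ℕ → ℝ) (y : ℕ → X), (∀ j, 0 ≤ ν j) ∧ ∑' j, ν j = 1 ∧ (∀ j, ∃ ω, y j = x ω) ∧
      ∀ R : X → ℝ, ∑' j, ν j * R (y j) = ∑ ω, m ω * R (x ω) := by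
  classical
  obtain ⟨ω₀⟩ := ‹Nonempty Ω›
  let e := Fintype.equivFin Ω
  let ω : ℕ → Ω := fun j => if h : j < Fintype.card Ω then e.symm ⟨j, h⟩ else ω₀
  let ν : ℕ → ℝ := fun j => if j < Fintype.card Ω then m (ω j) else 0
  have hω : ∀ j : Fin (Fintype.card Ω), ω j = e.symm j := fun j => by simp [ω]
  have hR : ∀ R : X → ℝ, ∑' j, ν j * R (x (ω j)) = ∑ ω, m ω * R (x ω) := by
    intro R
    rw [tsum_eq_sum (s := range (Fintype.card Ω)), Finset.sum_range,
      ← e.symm.sum_comp]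
    · refine Finset.sum_congr rfl fun j _ => ?_
      simp [ν, hω]
    · intro j hj
      have : ¬ j < Fintype.card Ω := by simpa using hj
      simp [ν, this]
  refine ⟨ν, fun j => x (ω j), fun j => ?_, ?_, fun j => ⟨_, rfl⟩, hR⟩
  · simp only [ν]
    split_ifs
    exacts [hm _, le_rfl]
  · simpa [hm1] using hR fun _ => 1

/-- The law of a uniformly random code and independent episode seeds. -/
noncomputable def mixtureLaw (A n K : ℕ) (ε : ℝ)
    (ω : (Fin (n + 1) → Fin A) × (Fin K → (Fin n → Fin 2) × Bool × Bool)) : ℝ :=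
  ((A : ℝ) ^ (n + 1))⁻¹ * ∏ k, lockLaw n ε (ω.2 k)

lemma sum_lockLaw (n : ℕ) (ε : ℝ) : ∑ β, lockLaw n ε β = 1 := by
  have := sum_lockLaw_mul n ε fun _ => 1
  simp only [mul_one] at this
  rw [this]; ring

lemma sum_mixtureLaw_mul (A n K : ℕ) (ε : ℝ)
    (F : (Fin (n + 1) → Fin A) × (Fin K → (Fin n → Fin 2) × Bool × Bool) → ℝ) :
    ∑ ω, mixtureLaw A n K ε ω * F ω = ((A : ℝ) ^ (n + 1))⁻¹ *
      ∑ c, ∑ β, (∏ k, lockLaw n ε (β k)) * F (c, β) := by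
  simp only [mixtureLaw, Fintype.sum_prod_type, Finset.mul_sum, mul_assoc]

lemma sum_prod_lockLaw (n K : ℕ) (ε : ℝ) :
    ∑ β : Fin K → (Fin n → Fin 2) × Bool × Bool, ∏ k, lockLaw n ε (β k) = 1 :=
  sum_seqWeight (D := fun _ _ => lockLaw n ε) (fun _ _ => sum_lockLaw n ε) K

lemma sum_mixtureLaw (hA : 0 < A) (n K : ℕ) (ε : ℝ) : ∑ ω, mixtureLaw A n K ε ω = 1 := by
  have := sum_mixtureLaw_mul A n K ε fun _ => 1
  simp only [mul_one] at this
  rw [this]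
  have : (A : ℝ) ≠ 0 := by positivity
  simp [sum_prod_lockLaw, this]

/-- The mean loss of the hidden code. -/
lemma sum_mixtureLaw_mul_bitLoss (hA : 0 < A) (n K : ℕ) (ε : ℝ) :
    ∑ ω, mixtureLaw A n K ε ω * ∑ k, bitLoss (ω.2 k).2.1 = (1 / 2 - ε) * K := by
  rw [sum_mixtureLaw_mul]
  have h := sum_seqWeight_mul_sum (D := fun _ _ => lockLaw n ε) (fun _ _ => sum_lockLaw n ε)
    (fun _ _ β => bitLoss β.2.1) K
  have h' : ∑ β, lockLaw n ε β * bitLoss β.2.1 = 1 / 2 - ε := by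
    rw [sum_lockLaw_mul]; simp [bitLoss]
  simp only [h', ← Finset.sum_mul, sum_seqWeight (D := fun _ _ => lockLaw n ε)
    (fun _ _ => sum_lockLaw n ε) K] at h
  have hA' : (A : ℝ) ≠ 0 := by positivity
  unfold seqWeight at h
  simp only [h]
  simp
  field_simp

lemma expRegret_lock_ge (alg : Alg 2 A (BanditObs 2 A (n + 1))) (s₀ : Fin 2)
    (c : Fin (n + 1) → Fin A) (β : Fin K → (Fin n → Fin 2) × Bool × Bool) :
    algValue (n + 1) K alg (lockInstTrans c s₀ β) (lockInstLoss c s₀ β)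
        (banditObs (n + 1) (lockInstLoss c s₀ β)) s₀ - ∑ k, bitLoss (β k).2.1 ≤
      expRegret (n + 1) K alg (lockInstTrans c s₀ β) (lockInstLoss c s₀ β)
        (banditObs (n + 1) (lockInstLoss c s₀ β)) s₀ := by
  refine sub_le_sub_left ?_ _
  refine (bestValue_le (fun k h => isKernel_lockTrans _ _ _ _)
    (fun k h s a => lockLoss_nonneg _ _ _ _ _ _ _) (isPolicy_codePolicy c)).trans_eq ?_
  rw [Finset.sum_range]
  refine Finset.sum_congr rfl fun k _ => ?_
  rw [← lockSeed_val β k]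
  exact value_codePolicy _ _ _ _

/-- The expected value of the learner on the mixture of lock instances. -/
lemma sum_mixtureLaw_mul_algValue_ge (alg : Alg 2 A (BanditObs 2 A (n + 1))) (s₀ : Fin 2)
    (hA : 2 ≤ A) {ε : ℝ} (h0 : 0 ≤ ε) (h1 : ε ^ 2 ≤ 1 / 8)
    (hK : 288 * ε ^ 2 * K ≤ (A : ℝ) ^ (n + 1)) :
    (1 / 2 - 3 / 4 * ε) * K ≤ ∑ ω, mixtureLaw A n K ε ω *
      algValue (n + 1) K alg (lockInstTrans ω.1 s₀ ω.2) (lockInstLoss ω.1 s₀ ω.2)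
        (banditObs (n + 1) (lockInstLoss ω.1 s₀ ω.2)) s₀ := by
  have hw : Summable alg.w := by
    by_contra h
    have := alg.w_sum
    rw [tsum_eq_zero_of_not_summable h] at this
    exact zero_ne_one this
  set F : (Fin (n + 1) → Fin A) × (Fin K → (Fin n → Fin 2) × Bool × Bool) → ℕ → ℝ :=
    fun ω i => ∑ ts : Fin K → Fin (n + 1) → Fin 2 × Fin A,
      seqProb alg i (lockInstTrans ω.1 s₀ ω.2)
        (banditObs (n + 1) (lockInstLoss ω.1 s₀ ω.2)) s₀ ts *
      playedValue (n + 1) K alg i (lockInstTrans ω.1 s₀ ω.2) (lockInstLoss ω.1 s₀ ω.2)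
        (banditObs (n + 1) (lockInstLoss ω.1 s₀ ω.2)) s₀ ts with hF
  have hF' : ∀ ω i, 0 ≤ F ω i ∧ F ω i ≤ K := by
    intro ω i
    have hp : ∀ k h, IsKernel (lockInstTrans ω.1 s₀ ω.2 k h) :=
      fun k h => isKernel_lockTrans _ _ _ _
    have hloss : ∀ (k : ℕ) (t : Fin (n + 1) → Fin 2 × Fin A),
        0 ≤ trajLoss (n + 1) (lockInstLoss ω.1 s₀ ω.2 k) t ∧
          trajLoss (n + 1) (lockInstLoss ω.1 s₀ ω.2 k) t ≤ 1 := by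
      intro k t
      unfold lockInstLoss
      rw [trajLoss_lockLoss]
      exact ⟨bitLoss_nonneg _, bitLoss_le_one _⟩
    simp only [hF]
    rw [sum_seqProb_mul_playedValue alg i hp]
    constructor
    · exact Finset.sum_nonneg fun ts _ => mul_nonneg (seqProb_nonneg alg i hp _ _ ts)
        (Finset.sum_nonneg fun k _ => (hloss _ _).1)
    · rw [← one_mul (K : ℝ), ← sum_seqProb alg i hp
        (banditObs (n + 1) (lockInstLoss ω.1 s₀ ω.2)) s₀ (K := K), Finset.sum_mul]
      refine Finset.sum_le_sum fun ts _ =>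
        mul_le_mul_of_nonneg_left ?_ (seqProb_nonneg alg i hp _ _ ts)
      refine (Finset.sum_le_sum fun k _ => (hloss _ _).2).trans_eq ?_
      simp
  have hsum : ∀ ω, Summable fun i => alg.w i * F ω i := fun ω =>
    Summable.of_nonneg_of_le (fun i => mul_nonneg (alg.w_nonneg i) (hF' ω i).1)
      (fun i => mul_le_mul_of_nonneg_left (hF' ω i).2 (alg.w_nonneg i)) (hw.mul_right (K : ℝ))
  have hAn : (0 : ℝ) < (A : ℝ) ^ (n + 1) := by positivity
  have hcard : Fintype.card (Fin (n + 1) → Fin A) = A ^ (n + 1) := by simp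
  have hseed : ∀ i, (1 / 2 - 3 / 4 * ε) * K ≤ ∑ ω, mixtureLaw A n K ε ω * F ω i := by
    intro i
    rw [sum_mixtureLaw_mul, le_inv_mul_iff₀ hAn]
    simp only [hF, sum_lock_eq_sum_bandit]
    have hq0 : ∀ k h t, 0 ≤ unifStep alg i s₀ k h t := fun k h t =>
      trajDist_nonneg isKernel_unifTrans (alg.act_strat _ _) _ _
    have hq1 : ∀ k h, ∑ t, unifStep alg i s₀ k h t = 1 := fun k h =>
      sum_trajDist isKernel_unifTrans (alg.act_strat _ _) _
    have := bandit_lower_bound (ι := Fin (n + 1) → Fin A)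
      (arm := fun (t : Fin (n + 1) → Fin 2 × Fin A) h => (t h).2) hq0 hq1 h0 h1 K
      (by rw [hcard]; push_cast; exact hK)
      (by rw [hcard]; exact hA.trans (Nat.le_self_pow n.succ_ne_zero A))
    rw [hcard] at this
    push_cast at this
    exact this
  calc (1 / 2 - 3 / 4 * ε) * K = ∑' i, alg.w i * ((1 / 2 - 3 / 4 * ε) * K) := by
        rw [tsum_mul_right, alg.w_sum, one_mul]
    _ ≤ ∑' i, ∑ ω, mixtureLaw A n K ε ω * (alg.w i * F ω i) := by
        refine Summable.tsum_le_tsum (fun i => ?_) (hw.mul_right _)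
          (summable_sum fun ω _ => (hsum ω).mul_left _)
        refine (mul_le_mul_of_nonneg_left (hseed i) (alg.w_nonneg i)).trans_eq ?_
        rw [Finset.mul_sum]
        exact Finset.sum_congr rfl fun ω _ => by ring
    _ = ∑ ω, mixtureLaw A n K ε ω * ∑' i, alg.w i * F ω i := by
        rw [Summable.tsum_finsetSum fun ω _ => (hsum ω).mul_left _]
        exact Finset.sum_congr rfl fun ω _ => tsum_mul_left
    _ = _ := rfl

end Mixture

/-- **Two-state lower bound for B/B feedback** (Lemma `lem:small_S`).
Fix integers `A ≥ 2`, `H ≥ 1` and `K ≥ A^H`.  There is a universal constant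
`c > 0` such that for every learning algorithm with bandit feedback on both
losses and transitions there is an episodic adversarial MDP instance with
exactly `S = 2` states — possibly with stochastically generated losses and
transitions, modelled as a mixture `ν` over (deterministic) instances — whose
expected regret is at least `c · √(A^H · K)`. -/
theorem two_state_bandit_bandit_lower_bound :
    ∃ c : ℝ, 0 < c ∧
      ∀ (A H K : ℕ), 2 ≤ A → 1 ≤ H → A ^ H ≤ K →
      ∀ (sinit : Fin 2) (learner : Alg 2 A (BanditObs 2 A H)),
      ∃ (ν : ℕ → ℝ) (p : ℕ → ℕ → ℕ → Fin 2 → Fin A → Fin 2 → ℝ)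
        (ℓ : ℕ → ℕ → ℕ → Fin 2 → Fin A → ℝ),
        (∀ j, 0 ≤ ν j) ∧ (∑' j, ν j = 1) ∧
        (∀ j k, IsTrans H (p j k)) ∧ (∀ j k, IsLoss H (ℓ j k)) ∧
        c * Real.sqrt ((A : ℝ) ^ H * K) ≤
          ∑' j : ℕ, ν j * expRegret H K learner (p j) (ℓ j) (banditObs H (ℓ j)) sinit := by
  refine ⟨1 / 80, by norm_num, fun A H K hA hH hK s₀ learner => ?_⟩
  obtain ⟨n, rfl⟩ : ∃ n, H = n + 1 := ⟨H - 1, by omega⟩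
  have hN : (0 : ℝ) < (A : ℝ) ^ (n + 1) := by
    have : 0 < A := by omega
    positivity
  have hNK : (A : ℝ) ^ (n + 1) ≤ K := by exact_mod_cast hK
  have hK0 : (0 : ℝ) < K := hN.trans_le hNK
  set N : ℝ := (A : ℝ) ^ (n + 1) with hNdef
  set ε : ℝ := 1 / 20 * √(N / K) with hε
  have h0 : 0 ≤ ε := by positivity
  have hsq : ε ^ 2 = 1 / 400 * (N / K) := by
    rw [hε, mul_pow, Real.sq_sqrt (by positivity)]; norm_num
  have hle : N / K ≤ 1 := (div_le_one hK0).2 hNK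
  have h1 : ε ^ 2 ≤ 1 / 8 := by rw [hsq]; linarith
  have h2 : 288 * ε ^ 2 * K ≤ N := by
    have : N / K * K = N := div_mul_cancel₀ _ hK0.ne'
    rw [hsq]; nlinarith
  have hhalf : ε ≤ 1 / 2 := by nlinarith
  have hεK : ε * K = 1 / 20 * √(N * K) := by
    rw [hε, mul_assoc]
    congr 1
    rw [← Real.sqrt_sq hK0.le, ← Real.sqrt_mul (by positivity), Real.sqrt_sq hK0.le]
    congr 1
    field_simp
  have hm0 : ∀ ω, 0 ≤ mixtureLaw A n K ε ω := fun ω => mul_nonneg (by positivity)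
    (Finset.prod_nonneg fun k _ => lockLaw_nonneg h0 hhalf _)
  have : Nonempty (Fin A) := ⟨⟨0, by omega⟩⟩
  obtain ⟨ν, y, hν0, hν1, hy, hR⟩ := exists_nat_mixture hm0 (sum_mixtureLaw (by omega) n K ε)
    fun ω => (lockInstTrans ω.1 s₀ ω.2, lockInstLoss ω.1 s₀ ω.2)
  refine ⟨ν, fun j => (y j).1, fun j => (y j).2, hν0, hν1, fun j k h _ => ?_,
    fun j k h s a _ => ?_, ?_⟩
  · obtain ⟨ω, hω⟩ := hy j
    simp only [hω]
    exact isKernel_lockTrans _ _ _ _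
  · obtain ⟨ω, hω⟩ := hy j
    simp only [hω]
    exact ⟨lockLoss_nonneg _ _ _ _ _ _ _, lockLoss_le_one _ _ _ _ _ _ _⟩
  · rw [hR fun x => expRegret (n + 1) K learner x.1 x.2 (banditObs (n + 1) x.2) s₀]
    have hV := sum_mixtureLaw_mul_algValue_ge learner s₀ hA h0 h1 h2
    have hC := sum_mixtureLaw_mul_bitLoss (A := A) (by omega) n K ε
    have hreg := Finset.sum_le_sum fun ω (_ : ω ∈ Finset.univ) => mul_le_mul_of_nonneg_left
      (expRegret_lock_ge learner s₀ ω.1 ω.2) (hm0 ω)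
    simp only [mul_sub, Finset.sum_sub_distrib] at hreg
    rw [hC] at hreg
    refine le_trans ?_ hreg
    linarith

end AdvMDP
end
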